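/- Let 𝔤₁ and 𝔤₂ be finite-dimensional complex semisimple Lie algebras with Cartan subalgebras 𝔥₁, 𝔥₂, positive systems Δ₁⁺, Δ₂⁺, and let 𝔫ᵢ = ⊕_{α∈Δᵢ⁺} (𝔤ᵢ)_α be the nilradical of the associated Borel subalgebra of 𝔤ᵢ. If 𝔫₁ and 𝔫₂ are isomorphic as complex Lie algebras, then 𝔤₁ and 𝔤₂ are isomorphic as complex Lie algebras. -/

import Mathlib

noncomputable section

variable {g : Type*} [LieRing g] [LieAlgebra ℂ g]

/-- The root space of a linear functional `α` on the Cartan subalgebra `h`: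
`𝔤_α = {x ∈ 𝔤 | [H, x] = α(H) • x for all H ∈ 𝔥}`. -/
def rootSpaceOf (h : LieSubalgebra ℂ g) (α : Module.Dual ℂ h) : Submodule ℂ g where
  carrier := {x | ∀ H : h, ⁅(H : g), x⁆ = α H • x}
  add_mem' := by
    intro x y hx hy H
    rw [lie_add, hx H, hy H, smul_add]
  zero_mem' := by intro H; simp
  smul_mem' := by
    intro c x hx H
    rw [lie_smul, hx H, smul_comm]

/-- The set of roots of `𝔤` relative to the Cartan subalgebra `h`. -/
def rootsOf (h : LieSubalgebra ℂ g) : Set (Module.Dual ℂ h) :=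
  {α | α ≠ 0 ∧ rootSpaceOf h α ≠ ⊥}

/-- `P` is a positive system of roots: `P` consists of roots, every root is exactly one of
positive or negative, and `P` is closed under addition. -/
def IsPositiveSystem (h : LieSubalgebra ℂ g) (P : Set (Module.Dual ℂ h)) : Prop :=
  P ⊆ rootsOf h ∧ (∀ α ∈ rootsOf h, α ∈ P ↔ -α ∉ P) ∧
    ∀ α ∈ P, ∀ β ∈ P, α + β ∈ rootsOf h → α + β ∈ P

namespace LieAlgebra.Basis

open Function LieSubalgebra Set

variable {ι K L₁ L₂ : Type*} [Finite ι] [Field K] [LieRing L₁] [LieRing L₂]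
  [LieAlgebra K L₁] {H₁ : LieSubalgebra K L₁} (b₁ : Basis ι H₁)
  [LieAlgebra K L₂] {H₂ : LieSubalgebra K L₂} (b₂ : Basis ι H₂)

/-- The diagonal subalgebra of `L₁ × L₂` generated by the pairs of Chevalley generators. -/
def diag : LieSubalgebra K (L₁ × L₂) :=
  .lieSpan _ _ <| range (fun i ↦ (b₁.e i, b₂.e i)) ∪ range (fun i ↦ (b₁.f i, b₂.f i))

/-- The pair of raising generators. -/
def diagE (i : ι) : diag b₁ b₂ :=
  ⟨(b₁.e i, b₂.e i), subset_lieSpan <| .inl <| mem_range_self i⟩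

/-- The pair of lowering generators. -/
def diagF (i : ι) : diag b₁ b₂ :=
  ⟨(b₁.f i, b₂.f i), subset_lieSpan <| .inr <| mem_range_self i⟩

/-- The pair of Cartan generators. -/
def diagH (i : ι) : diag b₁ b₂ := ⟨(b₁.h i, b₂.h i), by
  have := (diag b₁ b₂).lie_mem (diagE b₁ b₂ i).2 (diagF b₁ b₂ i).2
  simpa [diagE, diagF, (b₁.sl2 i).lie_e_f, (b₂.sl2 i).lie_e_f] using this⟩

lemma lieSpan_diagE_diagF :
    lieSpan K (diag b₁ b₂) (range (diagE b₁ b₂) ∪ range (diagF b₁ b₂)) = ⊤ := by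
  have hr : range (diagE b₁ b₂) ∪ range (diagF b₁ b₂) = Subtype.val ⁻¹'
      (range (fun i ↦ (b₁.e i, b₂.e i)) ∪ range (fun i ↦ (b₁.f i, b₂.f i))) := by
    ext; simp [Subtype.ext_iff, diagE, diagF]
  rw [hr]
  exact lieSpan_lieSpan_coe_preimage

/-- The basis carried by the diagonal subalgebra of two based Lie algebras with the same
Cartan matrix. -/
def diagBasis (hA : b₁.A = b₂.A) : Basis ι (lieSpan K (diag b₁ b₂) (range (diagH b₁ b₂))) where
  A := b₁.A
  h := diagH b₁ b₂
  e := diagE b₁ b₂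
  f := diagF b₁ b₂
  cartan_eq_lieSpan := rfl
  span_ef := lieSpan_diagE_diagF b₁ b₂
  linInd := .of_comp (diag b₁ b₂).subtype <| .of_comp (LinearMap.fst K L₁ L₂) b₁.linInd
  nondegen := b₁.nondegen
  sl2 i :=
    { h_ne_zero := by simp [Subtype.ext_iff, diagH, (b₁.sl2 i).h_ne_zero]
      lie_e_f := by
        simp [Subtype.ext_iff, diagH, diagE, diagF, (b₁.sl2 i).lie_e_f, (b₂.sl2 i).lie_e_f]
      lie_h_e_nsmul := by
        simp [Subtype.ext_iff, diagH, diagE, (b₁.sl2 i).lie_h_e_nsmul, (b₂.sl2 i).lie_h_e_nsmul]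
      lie_h_f_nsmul := by
        simp [Subtype.ext_iff, diagH, diagF, (b₁.sl2 i).lie_h_f_nsmul, (b₂.sl2 i).lie_h_f_nsmul] }
  lie_h_h i j := by simp [Subtype.ext_iff, diagH, b₁.lie_h_h, b₂.lie_h_h]
  lie_h_e i j := by simp [Subtype.ext_iff, diagH, diagE, b₁.lie_h_e, b₂.lie_h_e, ← hA]
  lie_h_f i j := by simp [Subtype.ext_iff, diagH, diagF, b₁.lie_h_f, b₂.lie_h_f, ← hA]
  lie_e_f_ne i j hij := by
    simp [Subtype.ext_iff, diagE, diagF, b₁.lie_e_f_ne i j hij, b₂.lie_e_f_ne i j hij]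

lemma surjective_fst_diag : Surjective ((LieHom.fst K L₁ L₂).comp (diag b₁ b₂).incl) := by
  rw [← LieHom.range_eq_top, eq_top_iff, ← b₁.span_ef, lieSpan_le]
  rintro - (⟨i, rfl⟩ | ⟨i, rfl⟩)
  · exact ⟨diagE b₁ b₂ i, rfl⟩
  · exact ⟨diagF b₁ b₂ i, rfl⟩

lemma surjective_snd_diag : Surjective ((LieHom.snd K L₁ L₂).comp (diag b₁ b₂).incl) := by
  rw [← LieHom.range_eq_top, eq_top_iff, ← b₂.span_ef, lieSpan_le]
  rintro - (⟨i, rfl⟩ | ⟨i, rfl⟩)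
  · exact ⟨diagE b₁ b₂ i, rfl⟩
  · exact ⟨diagF b₁ b₂ i, rfl⟩

lemma snd_eq_zero_of_mem_cartan_diag {y : diag b₁ b₂}
    (hA : b₁.A = b₂.A) (hy : y ∈ lieSpan K (diag b₁ b₂) (range (diagH b₁ b₂)))
    (h0 : y.1.1 = 0) : y = 0 := by
  have hy' : y ∈ Submodule.span K (range (diagH b₁ b₂)) := by
    rw [← show _ = Submodule.span K (range (diagH b₁ b₂)) from
      (diagBasis b₁ b₂ hA).coe_cartan_eq_span]
    exact hy
  obtain ⟨c, rfl⟩ := (Finsupp.mem_span_range_iff_exists_finsupp).mp hy'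
  let p : diag b₁ b₂ →ₗ[K] L₁ := LinearMap.fst K L₁ L₂ ∘ₗ (diag b₁ b₂).toSubmodule.subtype
  have hc : Finsupp.linearCombination K b₁.h c = 0 := by
    rw [Finsupp.linearCombination_apply, ← h0]
    change _ = p _
    rw [map_finsuppSum]
    rfl
  rw [(LinearMap.map_eq_zero_iff _ b₁.linInd).mp hc]
  simp

end LieAlgebra.Basis

namespace LieAlgebra.IsKilling

variable {K L : Type*} [Field K] [CharZero K] [LieRing L] [LieAlgebra K L] [Module.Finite K L]
  [IsKilling K L] {H : LieSubalgebra K L} [H.IsCartanSubalgebra] [LieModule.IsTriangularizable K H L]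

lemma exists_ne_zero_mem_cartan_of_ne_bot {I : LieIdeal K L} (hI : I ≠ ⊥) :
    ∃ y ∈ I, y ∈ H ∧ y ≠ 0 := by
  by_contra! hcon
  have h1 : I.restr H ⊓ H.toLieSubmodule = ⊥ := by
    rw [LieSubmodule.eq_bot_iff]
    exact fun y hy ↦ hcon y hy.1 hy.2
  have h2 := I.restr_inf_cartan_eq_biSup_corootSubmodule (H := H)
  rw [h1, eq_comm, iSup₂_eq_bot] at h2
  have h3 := lieIdeal_eq_inf_cartan_sup_biSup_rootSpace (H := H) I
  apply hI
  have h4 : ∀ α : H.root, α ∉ I.rootSet := by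
    intro α hα
    have := coe_coroot_mem_corootSubmodule α.1
    rw [h2 α hα] at this
    simp at this
  rw [h1] at h3
  rw [LieSubmodule.eq_bot_iff]
  intro y hy
  have : y ∈ I.restr H := hy
  rw [h3] at this
  have h5 : ⨆ α ∈ I.rootSet, LieAlgebra.rootSpace H α.1 = ⊥ := by
    simp [h4]
  rw [bot_sup_eq] at this
  replace this : y ∈ ⨆ α ∈ I.rootSet, LieAlgebra.rootSpace H α.1 := this
  rwa [h5, LieSubmodule.mem_bot] at this

end LieAlgebra.IsKilling

namespace LieAlgebra.Basis

open Function LieSubalgebra Set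

variable {ι K L₁ L₂ : Type*} [Finite ι] [Field K] [CharZero K] [LieRing L₁] [LieRing L₂]
  [LieAlgebra K L₁] [Module.Finite K L₁] {H₁ : LieSubalgebra K L₁} (b₁ : Basis ι H₁)
  [LieAlgebra K L₂] [Module.Finite K L₂] {H₂ : LieSubalgebra K L₂} (b₂ : Basis ι H₂)

lemma injective_fst_diag [IsKilling K L₂] [LieModule.IsTriangularizable K H₂ L₂]
    (hA : b₁.A = b₂.A) : Injective ((LieHom.fst K L₁ L₂).comp (diag b₁ b₂).incl) := by
  have := Fintype.ofFinite ι
  have := b₂.isCartanSubalgebra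
  have := (diagBasis b₁ b₂ hA).isCartanSubalgebra
  set p₁ := (LieHom.fst K L₁ L₂).comp (diag b₁ b₂).incl with hp₁
  set p₂ := (LieHom.snd K L₁ L₂).comp (diag b₁ b₂).incl with hp₂
  set I₂ : LieIdeal K L₂ := p₁.ker.map p₂ with hI₂
  have hI (y : L₂) (hy : y ∈ I₂) : ∃ z : diag b₁ b₂, z.1 = (0, y) := by
    have h1 : (I₂ : Set L₂) = p₂ '' p₁.ker :=
      congr_arg SetLike.coe <| p₁.ker.coe_map_of_surjective (surjective_snd_diag b₁ b₂)
    obtain ⟨z, hz, rfl⟩ : y ∈ p₂ '' p₁.ker := h1 ▸ hy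
    exact ⟨z, Prod.ext hz rfl⟩
  have hbot : I₂ = ⊥ := by
    by_contra hne
    obtain ⟨y, hyI, hyH, hy0⟩ := IsKilling.exists_ne_zero_mem_cartan_of_ne_bot (H := H₂) hne
    obtain ⟨z, hz⟩ := hI y hyI
    suffices z = 0 by
      rw [this] at hz
      exact hy0 (congr_arg Prod.snd hz).symm
    refine snd_eq_zero_of_mem_cartan_diag b₁ b₂ hA ?_ (by simp [hz])
    rw [← IsCartanSubalgebra.self_normalizing
      (H := lieSpan K (diag b₁ b₂) (range (diagH b₁ b₂))), mem_normalizer_iff']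
    intro w hw
    have hw' : w ∈ Submodule.span K (range (diagH b₁ b₂)) := by
      rw [← show _ = Submodule.span K (range (diagH b₁ b₂)) from
        (diagBasis b₁ b₂ hA).coe_cartan_eq_span]
      exact hw
    clear hw
    suffices ⁅w, z⁆ = 0 by rw [this]; exact zero_mem _
    induction hw' using Submodule.span_induction with
    | mem u hu =>
      obtain ⟨i, rfl⟩ := hu
      have := b₂.isLieAbelian_cartan
      have h1 : ⁅b₂.h' i, (⟨y, hyH⟩ : H₂)⁆ = 0 := trivial_lie_zero ..
      have h2 : ⁅b₂.h i, y⁆ = 0 := by simpa [Subtype.ext_iff, h'] using h1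
      simp [Subtype.ext_iff, hz, diagH, h2]
    | zero => simp
    | add u v hu hv hu' hv' => rw [add_lie, hu', hv', add_zero]
    | smul t u hu hu' => rw [smul_lie, hu', smul_zero]
  rw [← LieHom.ker_eq_bot, LieSubmodule.eq_bot_iff]
  intro z hz
  have h2 : p₂ z ∈ I₂ := LieIdeal.mem_map hz
  rw [hbot] at h2
  exact Subtype.ext (Prod.ext hz h2)

/-- Based Lie algebras with the same Cartan matrix are equivalent. -/
theorem nonempty_equiv_of_A_eq [IsKilling K L₁] [LieModule.IsTriangularizable K H₁ L₁]
    [IsKilling K L₂] [LieModule.IsTriangularizable K H₂ L₂]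
    (hA : b₁.A = b₂.A) : Nonempty (L₁ ≃ₗ⁅K⁆ L₂) := by
  let e₁ : diag b₁ b₂ ≃ₗ⁅K⁆ L₁ :=
    .ofBijective _ ⟨injective_fst_diag b₁ b₂ hA, surjective_fst_diag b₁ b₂⟩
  let e₂ : diag b₂ b₁ ≃ₗ⁅K⁆ L₂ :=
    .ofBijective _ ⟨injective_fst_diag b₂ b₁ hA.symm, surjective_fst_diag b₂ b₁⟩
  let q₁ : L₁ →ₗ⁅K⁆ L₂ := ((LieHom.snd K L₁ L₂).comp (diag b₁ b₂).incl).comp e₁.symm.toLieHom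
  let q₂ : L₂ →ₗ⁅K⁆ L₁ := ((LieHom.snd K L₂ L₁).comp (diag b₂ b₁).incl).comp e₂.symm.toLieHom
  have hq₁ : Surjective q₁ := (surjective_snd_diag b₁ b₂).comp e₁.symm.surjective
  have hq₂ : Surjective q₂ := (surjective_snd_diag b₂ b₁).comp e₂.symm.surjective
  have hle := LinearMap.finrank_le_finrank_of_surjective (f := (q₁ : L₁ →ₗ[K] L₂)) hq₁
  have hge := LinearMap.finrank_le_finrank_of_surjective (f := (q₂ : L₂ →ₗ[K] L₁)) hq₂
  have hinj : Injective q₁ :=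
    (LinearMap.injective_iff_surjective_of_finrank_eq_finrank (f := (q₁ : L₁ →ₗ[K] L₂))
      (le_antisymm hge hle)).mpr hq₁
  exact ⟨.ofBijective q₁ ⟨hinj, hq₁⟩⟩

end LieAlgebra.Basis

namespace LieAlgebra.IsKilling

open LieModule Module

variable {K L : Type*} [Field K] [CharZero K] [LieRing L] [LieAlgebra K L] [Module.Finite K L]
  [IsKilling K L] {H : LieSubalgebra K L} [H.IsCartanSubalgebra] [LieModule.IsTriangularizable K H L]

lemma exists_smul_eq_of_mem_rootSpace {α : Weight K H L} (hα : α.IsNonZero) {x y : L}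
    (hx : x ∈ rootSpace H α) (hx0 : x ≠ 0) (hy : y ∈ rootSpace H α) : ∃ c : K, c • x = y := by
  simpa using (finrank_eq_one_iff_of_nonzero' (⟨x, hx⟩ : rootSpace H α) (by simpa using hx0)).mp
    (finrank_rootSpace_eq_one _ hα) ⟨_, hy⟩

lemma lie_ne_zero_of_mem_rootSpace {α β : Weight K H L} (hα : α.IsNonZero) (hβ : β.IsNonZero)
    (hαβ : rootSpace H (α + β : H → K) ≠ ⊥) {e x : L} (he : e ∈ rootSpace H α) (he0 : e ≠ 0)
    (hx : x ∈ rootSpace H β) (hx0 : x ≠ 0) : ⁅e, x⁆ ≠ 0 := by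
  obtain ⟨h, e', f, isSl2, he', hf⟩ := exists_isSl2Triple_of_weight_isNonZero hα
  obtain rfl := isSl2.h_eq_coroot hα he' hf
  obtain ⟨c, rfl⟩ := exists_smul_eq_of_mem_rootSpace hα he he0 he'
  obtain ⟨v, hv, hv0⟩ := (chainTop α β).exists_ne_zero
  have prim : isSl2.HasPrimitiveVectorWith v (chainLength α β : K) :=
    have := lie_mem_genWeightSpace_of_mem_genWeightSpace he' hv
    ⟨hv0, (chainLength_smul _ _ hv).symm, by rwa [genWeightSpace_add_chainTop _ _ hα] at this⟩
  obtain ⟨k, hk⟩ : ∃ k, chainTopCoeff α β = k + 1 := by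
    refine Nat.exists_eq_succ_of_ne_zero fun h0 ↦ hαβ ?_
    simpa [h0] using genWeightSpace_chainTopCoeff_add_one_nsmul_add α β hα
  have hle := chainTopCoeff_le_chainLength α β
  have hy := toEnd_pow_apply_mem hf hv (k + 1)
  have hy0 := prim.pow_toEnd_f_ne_zero_of_eq_nat rfl (hk ▸ hle)
  have hw : ((k + 1) • (-α : H → K) + chainTop α β : H → K) = β := by
    rw [coe_chainTop', hk]; module
  rw [hw] at hy
  obtain ⟨d, rfl⟩ := exists_smul_eq_of_mem_rootSpace hβ hy hy0 hx
  intro h0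
  have h1 := prim.lie_e_pow_succ_toEnd_f k
  have h2 := prim.pow_toEnd_f_ne_zero_of_eq_nat rfl (show k ≤ chainLength α β by lia)
  rw [smul_lie, show ⁅e, (toEnd K L L f ^ (k + 1)) v⁆ = 0 by
    rw [lie_smul] at h0
    exact (smul_eq_zero.mp h0).resolve_left fun hd ↦ hx0 (by rw [hd, zero_smul]), smul_zero,
    eq_comm, smul_eq_zero_iff_left h2] at h1
  have h3 : ((chainLength α β - k : ℕ) : K) ≠ 0 := by
    rw [Nat.cast_ne_zero]; lia
  rw [Nat.cast_sub (by lia)] at h3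
  exact (mul_ne_zero (Nat.cast_add_one_ne_zero k) h3) h1

lemma exists_root_eq_of_rootSpace_ne_bot {χ : Dual K H} (h0 : χ ≠ 0)
    (h : rootSpace H (χ : H → K) ≠ ⊥) : ∃ i, (rootSystem H).root i = χ := by
  have hnz : (⟨χ, h⟩ : Weight K H L).IsNonZero := by
    intro hz
    exact h0 (DFunLike.coe_injective hz)
  exact ⟨⟨⟨χ, h⟩, by simpa using hnz⟩, by ext; rfl⟩

lemma span_range_coroot_support_eq (b : (rootSystem H).Base) :
    Submodule.span K (Set.range fun i : b.support ↦ ((coroot i.1.1 : H) : L)) = H.toSubmodule := by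
  have h1 := b.span_coroot_support
  have h2 : (rootSystem H).corootSpan K = ⊤ := RootPairing.IsRootSystem.span_coroot_eq_top
  rw [h2] at h1
  have h3 := congr_arg (Submodule.map H.toSubmodule.subtype) h1
  rw [Submodule.map_span, Submodule.map_top, Submodule.range_subtype] at h3
  rw [← h3]
  congr 1
  ext x
  simp

theorem exists_basis_of_base (b : (rootSystem H).Base) {ι : Type*} [Finite ι] (ε : ι ≃ b.support) :
    ∃ B : Basis ι H, ∀ i j, B.A i j = b.cartanMatrix (ε i) (ε j) := by
  have hnz (i : b.support) : (i.1.1 : Weight K H L).IsNonZero := H.isNonZero_coe_root i.1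
  choose h e f sl2 he hf using
    fun i : ι ↦ exists_isSl2Triple_of_weight_isNonZero (hnz (ε i))
  have hh (i : ι) : h i = (coroot (ε i).1.1 : H) := (sl2 i).h_eq_coroot (hnz _) (he i) (hf i)
  have hrange : Set.range h = Set.range fun i : b.support ↦ ((coroot i.1.1 : H) : L) := by
    rw [← ε.surjective.range_comp]
    exact congr_arg _ (funext hh)
  have hhh (i j : ι) : ⁅h i, h j⁆ = 0 := by
    rw [hh, hh]
    exact congr_arg Subtype.val (trivial_lie_zero H H (coroot (ε i).1.1) (coroot (ε j).1.1))
  have hA (i j : ι) : (b.cartanMatrix (ε i) (ε j) : K) = (ε i).1.1 (coroot (ε j).1.1) := by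
    rw [RootPairing.Base.cartanMatrix, ← rootSystem_pairing_apply]
    exact b.algebraMap_cartanMatrixIn_apply ℤ (ε i) (ε j)
  have hHspan : (LieSubalgebra.lieSpan K L (Set.range h)).toSubmodule =
      Submodule.span K (Set.range h) :=
    LieSubalgebra.coe_lieSpan_eq_span_of_forall_lie_eq_zero <| by
      rintro - ⟨i, rfl⟩ - ⟨j, rfl⟩
      exact hhh i j
  have hHeq : H = LieSubalgebra.lieSpan K L (Set.range h) := by
    rw [← LieSubalgebra.toSubmodule_inj, hHspan, hrange, span_range_coroot_support_eq]
  set N := LieSubalgebra.lieSpan K L (Set.range e ∪ Set.range f) with hN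
  have heN (i : ι) : e i ∈ N := LieSubalgebra.subset_lieSpan (.inl ⟨i, rfl⟩)
  have hfN (i : ι) : f i ∈ N := LieSubalgebra.subset_lieSpan (.inr ⟨i, rfl⟩)
  have step (α β γ : Weight K H L) (hα : α.IsNonZero) (hβ : β.IsNonZero) (hγ : γ.IsNonZero)
      (hsum : (γ : H → K) = α + β) (h1 : ∀ x ∈ rootSpace H α, x ∈ N)
      (h2 : ∀ x ∈ rootSpace H β, x ∈ N) : ∀ x ∈ rootSpace H γ, x ∈ N := by
    intro x hx
    obtain ⟨u, hu, hu0⟩ := α.exists_ne_zero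
    obtain ⟨v, hv, hv0⟩ := β.exists_ne_zero
    have hne := lie_ne_zero_of_mem_rootSpace hα hβ (hsum ▸ γ.2) hu hu0 hv hv0
    obtain ⟨c, rfl⟩ := exists_smul_eq_of_mem_rootSpace hγ
      (hsum ▸ lie_mem_genWeightSpace_of_mem_genWeightSpace hu hv) hne hx
    exact N.smul_mem c (N.lie_mem (h1 u hu) (h2 v hv))
  have hsimple (i : b.support) : (∀ x ∈ rootSpace H i.1.1, x ∈ N) ∧
      ∀ x ∈ rootSpace H (-i.1.1 : Weight K H L), x ∈ N := by
    obtain ⟨i, rfl⟩ := ε.surjective i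
    refine ⟨fun x hx ↦ ?_, fun x hx ↦ ?_⟩
    · obtain ⟨c, rfl⟩ := exists_smul_eq_of_mem_rootSpace (hnz _) (he i) (sl2 i).e_ne_zero hx
      exact N.smul_mem c (heN i)
    · obtain ⟨c, rfl⟩ := exists_smul_eq_of_mem_rootSpace (Weight.IsNonZero.neg (hnz (ε i)))
        (by simpa using hf i) (sl2 i).f_ne_zero hx
      exact N.smul_mem c (hfN i)
  have hall (i : H.root) : (∀ x ∈ rootSpace H i.1, x ∈ N) ∧
      ∀ x ∈ rootSpace H (-i.1 : Weight K H L), x ∈ N := by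
    induction i using b.induction_add with
    | h₀ i ih =>
      have hneg : ((rootSystem H).reflectionPerm i i).1 = -i.1 := by
        apply Weight.ext
        intro x
        have h1 : (rootSystem H).root ((rootSystem H).reflectionPerm i i) =
            -(rootSystem H).root i := by
          rw [RootPairing.root_reflectionPerm, RootPairing.reflection_apply_self]
        exact LinearMap.congr_fun h1 x
      rw [hneg, neg_neg]
      exact ih.symm
    | h₁ i hi => exact hsimple ⟨i, hi⟩
    | h₂ i j k hk ih hj =>
      have hk' : (k.1 : H → K) = i.1 + j.1 := funext fun x ↦ LinearMap.congr_fun hk x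
      refine ⟨step i.1 j.1 k.1 (H.isNonZero_coe_root _) (H.isNonZero_coe_root _)
        (H.isNonZero_coe_root _) hk' ih.1 (hsimple ⟨j, hj⟩).1, step (-i.1) (-j.1) (-k.1)
        (H.isNonZero_coe_root _).neg (H.isNonZero_coe_root _).neg (H.isNonZero_coe_root _).neg
        (by simp [hk', add_comm]) ih.2 (hsimple ⟨j, hj⟩).2⟩
  have hHN : H ≤ N := by
    rw [hHeq, LieSubalgebra.lieSpan_le]
    rintro - ⟨i, rfl⟩
    rw [← (sl2 i).lie_e_f]
    exact N.lie_mem (heN i) (hfN i)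
  have htop : N = ⊤ := by
    rw [eq_top_iff]
    change (⊤ : LieSubmodule K H L).toSubmodule ≤ _
    rw [← iSup_genWeightSpace_eq_top' K H L, LieSubmodule.iSup_toSubmodule, iSup_le_iff]
    intro χ x hx
    by_cases hχ : χ.IsZero
    · refine hHN ?_
      rw [hχ.eq] at hx
      simpa using hx
    · exact (hall ⟨χ, by simpa using hχ⟩).1 x hx
  refine ⟨{
    A := .of fun i j ↦ b.cartanMatrix (ε i) (ε j)
    h := h
    e := e
    f := f
    cartan_eq_lieSpan := hHeq
    span_ef := htop
    linInd := ?_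
    nondegen := ?_
    sl2 := sl2
    lie_h_h := hhh
    lie_h_e := fun i j ↦ ?_
    lie_h_f := fun i j ↦ ?_
    lie_e_f_ne := fun i j hij ↦ ?_ }, fun i j ↦ rfl⟩
  · have h1 : LinearIndependent K fun i : b.support ↦ (coroot i.1.1 : H) := b.linearIndepOn_coroot
    have h2 := (h1.comp ε ε.injective).map' H.toSubmodule.subtype
      (LinearMap.ker_eq_bot.mpr Subtype.val_injective)
    rw [show h = H.toSubmodule.subtype ∘ (fun i : b.support ↦ (coroot i.1.1 : H)) ∘ ε from
      funext hh]
    exact h2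
  · classical
    have := Fintype.ofFinite ι
    have h1 := b.cartanMatrix_nondegenerate
    rw [Matrix.nondegenerate_iff_det_ne_zero] at h1 ⊢
    rwa [← Matrix.det_submatrix_equiv_self ε] at h1
  · rw [hh, Matrix.of_apply, ← Int.cast_smul_eq_zsmul K, hA]
    exact lie_eq_smul_of_mem_rootSpace (he i) _
  · rw [hh, Matrix.of_apply, ← Int.cast_smul_eq_zsmul K, Int.cast_neg, hA]
    exact lie_eq_smul_of_mem_rootSpace (hf i) _
  · have hmem := lie_mem_genWeightSpace_of_mem_genWeightSpace (he i) (hf j)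
    suffices hbot : genWeightSpace L ((ε i).1.1 + -(ε j).1.1 : H → K) = ⊥ by
      rw [hbot] at hmem
      simpa using hmem
    by_contra hne
    have := b.sub_notMem_range_root (ε i).2 (ε j).2
    refine this (exists_root_eq_of_rootSpace_ne_bot (fun h0 ↦ hij ?_) ?_)
    · apply ε.injective
      exact Subtype.ext ((rootSystem H).root.injective (sub_eq_zero.mp h0))
    · rw [← sub_eq_add_neg] at hne
      exact hne

end LieAlgebra.IsKilling

namespace RootPairing

open IsAddIndecomposable Module

variable {ι R M N : Type*} [Finite ι] [AddCommGroup M] [AddCommGroup N] [Field R] [CharZero R]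
  [Module R M] [Module R N] {P : RootPairing ι R M N} [P.IsCrystallographic] [P.IsReduced]

lemma reflectionPerm_mem_of_add_mem {s : Set ι} (hneg : ∀ i, i ∈ s ↔ P.reflectionPerm i i ∉ s)
    (hadd : ∀ i ∈ s, ∀ j ∈ s, ∀ k, P.root k = P.root i + P.root j → k ∈ s)
    {i j : ι} (hi : i ∈ s) (hj : j ∈ s) (hij : P.pairingIn ℤ i j < 0) :
    P.reflectionPerm j i ∈ s := by
  have hli : LinearIndependent R ![P.root j, P.root i] := by
    by_contra h
    rcases IsReduced.eq_or_eq_neg j i h with h | h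
    · rw [P.root.injective h] at hij
      simp at hij
    · refine (hneg i).mp hi ?_
      have : P.reflectionPerm i i = j := P.root.injective (by simp [root_reflectionPerm, h])
      rwa [this]
  have key (n : ℕ) : n ≤ P.chainTopCoeff j i → ∀ k, P.root k = P.root i + n • P.root j → k ∈ s := by
    induction n with
    | zero =>
      intro _ k hk
      rw [P.root.injective (a₁ := k) (a₂ := i) (by simpa using hk)]
      exact hi
    | succ n ih =>
      intro hn k hk
      obtain ⟨l, hl⟩ := (root_add_nsmul_mem_range_iff_le_chainTopCoeff hli).mpr
        (show n ≤ P.chainTopCoeff j i by lia)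
      exact hadd l (ih (by lia) l hl) j hj k (by rw [hk, hl, succ_nsmul, add_assoc])
  have hroot : P.root (P.reflectionPerm j i) = P.root i + (-P.pairingIn ℤ i j).toNat • P.root j := by
    rw [root_reflectionPerm, reflection_apply_root, ← natCast_zsmul, Int.toNat_of_nonneg (by lia),
      ← P.algebraMap_pairingIn ℤ, neg_smul, ← sub_eq_add_neg, eq_intCast, Int.cast_smul_eq_zsmul]
  exact key _ ((root_add_nsmul_mem_range_iff_le_chainTopCoeff hli).mp ⟨_, hroot⟩) _ hroot

lemma sum_pairingIn_pos [Fintype ι] {s : Set ι} [DecidablePred (· ∈ s)]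
    (hneg : ∀ i, i ∈ s ↔ P.reflectionPerm i i ∉ s)
    (hadd : ∀ i ∈ s, ∀ j ∈ s, ∀ k, P.root k = P.root i + P.root j → k ∈ s)
    {j : ι} (hj : j ∈ s) : 0 < ∑ i with i ∈ s, P.pairingIn ℤ j i := by
  have hφ (i : ι) : P.pairingIn ℤ j (P.reflectionPerm j i) = -P.pairingIn ℤ j i := by
    apply Int.cast_injective (α := R)
    push_cast
    simp only [← eq_intCast (algebraMap ℤ R), algebraMap_pairingIn]
    rw [pairing_reflectionPerm, pairing_reflectionPerm_self_left]
  rw [← Finset.sum_filter_add_sum_filter_not _ (fun i ↦ P.reflectionPerm j i ∈ s),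
    Finset.sum_involution (fun i _ ↦ P.reflectionPerm j i), zero_add]
  · refine Finset.sum_pos' (fun i hi ↦ ?_) ⟨j, ?_, by simp⟩
    · simp only [Finset.mem_filter, Finset.mem_univ, true_and] at hi
      by_contra! hlt
      exact hi.2 (reflectionPerm_mem_of_add_mem hneg hadd hi.1 hj (by
        rwa [pairingIn_lt_zero_iff]))
    · simpa [hj] using (hneg j).mp hj
  · intro i _
    simp [hφ]
  · intro i _ h0 h
    have := hφ i
    rw [h] at this
    lia
  · intro i hi
    simpa [and_comm] using hi
  · simp

theorem exists_base_isPos_iff [P.IsRootSystem] {s : Set ι}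
    (hneg : ∀ i, i ∈ s ↔ P.reflectionPerm i i ∉ s)
    (hadd : ∀ i ∈ s, ∀ j ∈ s, ∀ k, P.root k = P.root i + P.root j → k ∈ s) :
    ∃ b : P.Base, ∀ i, b.IsPos i ↔ i ∈ s := by
  classical
  have := Fintype.ofFinite ι
  let := P.indexNeg
  obtain ⟨π, hπ⟩ : ∃ π : R →ₗ[ℚ] ℚ, π 1 = 1 := by
    obtain ⟨π, hπ⟩ := exists_dual_forall_apply_eq_one (K := ℚ) (v := fun _ : Unit ↦ (1 : R))
      (s := Set.univ) (by simp)
    exact ⟨π, hπ () (Set.mem_univ _)⟩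
  let f : M →+ ℚ := (π : R →+ ℚ).comp
    ((∑ i with i ∈ s, P.coroot' i : Dual R M) : M →+ R)
  have hf (j : ι) : f (P.root j) = ((∑ i with i ∈ s, P.pairingIn ℤ j i : ℤ) : ℚ) := by
    have h1 : ∑ i with i ∈ s, P.pairing j i = ((∑ i with i ∈ s, P.pairingIn ℤ j i : ℤ) : ℚ) • 1 := by
      simp [← P.algebraMap_pairingIn ℤ, Rat.smul_def]
    have h2 : f (P.root j) = π (∑ i with i ∈ s, P.pairing j i) := by
      simp [f]
    rw [h2, h1, map_smul, hπ, smul_eq_mul, mul_one]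
  have hpos (j : ι) (hj : j ∈ s) : 0 < f (P.root j) := by
    rw [hf]
    exact_mod_cast sum_pairingIn_pos hneg hadd hj
  have hnegpos (j : ι) (hj : j ∉ s) : f (P.root j) < 0 := by
    have := hpos (P.reflectionPerm j j) (by simpa using mt (hneg j).mpr hj)
    simpa [root_reflectionPerm] using this
  have hne (j : ι) : f (P.root j) ≠ 0 := by
    by_cases hj : j ∈ s
    exacts [(hpos j hj).ne', (hnegpos j hj).ne]
  let b : P.Base := .mk' P (baseOf P.root f) (P.linearIndepOn_root_baseOf f hne)
    (fun i ↦ mem_or_neg_mem_closure_baseOf P.root f i (hne i) (by simp))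
  have hb (i : ι) (hi : b.IsPos i) : 0 < f (P.root i) := by
    have hsupp (i : ι) (hi : i ∈ b.support) : 0 < f (P.root i) :=
      ((Set.toFinite (baseOf P.root f)).mem_toFinset.mp hi).1
    refine Base.IsPos.induction_on_add hi hsupp fun i j k hk hi hj ↦ ?_
    rw [hk, map_add]
    exact add_pos hi (hsupp j hj)
  have hb' (i : ι) (hi : b.IsPos i) : i ∈ s := by
    by_contra h
    exact (hb i hi).not_gt (hnegpos i h)
  refine ⟨b, fun i ↦ ⟨hb' i, fun hi ↦ ?_⟩⟩
  by_contra h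
  rw [← Base.IsPos.neg_iff_not] at h
  exact (hneg i).mp hi (hb' _ h)

end RootPairing

/-- The simultaneous eigenspace of a family of derivations with prescribed natural eigenvalues. -/
def LieDerivation.weightPart {K n ι : Type*} [Field K] [LieRing n] [LieAlgebra K n]
    (T : ι → LieDerivation K n n) (μ : ι → ℕ) : Submodule K n :=
  ⨅ a, LinearMap.ker ((T a : n →ₗ[K] n) - (μ a : K) • LinearMap.id)

open LieDerivation in
/-- A multigrading of a Lie algebra by derivations `T`, in which the degrees of total height one
are the lines spanned by the vectors `e`, sharing the features of the root grading of the nilradical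
of a Borel subalgebra. -/
structure NilradicalGrading (K n ι : Type*) [Field K] [LieRing n] [LieAlgebra K n] [Fintype ι]
    [DecidableEq ι] where
  e : ι → n
  T : ι → LieDerivation K n n
  iSup_weightPart : ⨆ μ, weightPart T μ = ⊤
  weightPart_zero : weightPart T 0 = ⊥
  weightPart_single : ∀ a, weightPart T (Pi.single a 1) = K ∙ e a
  e_ne_zero : ∀ a, e a ≠ 0
  weightPart_nsmul : ∀ a k, 2 ≤ k → weightPart T (k • Pi.single a 1) = ⊥
  weightPart_le : ∀ μ, 2 ≤ ∑ a, μ a → weightPart T μ ≤ Submodule.span K {m | ∃ x y : n, ⁅x, y⁆ = m}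
  weightPart_eq_bot_or : ∀ a b, a ≠ b →
    weightPart T (2 • Pi.single a 1 + Pi.single b 1) = ⊥ ∨
    weightPart T (2 • Pi.single b 1 + Pi.single a 1) = ⊥

namespace NilradicalGrading

open Submodule LieDerivation

variable {K n ι : Type*} [Field K] [LieRing n] [LieAlgebra K n] [Fintype ι] [DecidableEq ι]
  (G : NilradicalGrading K n ι)

/-- The component of multidegree `μ`. -/
abbrev part (μ : ι → ℕ) : Submodule K n := weightPart G.T μ

lemma mem_part {μ : ι → ℕ} {x : n} : x ∈ G.part μ ↔ ∀ a, G.T a x = (μ a : K) • x := by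
  simp [part, weightPart, sub_eq_zero]

@[elab_as_elim]
lemma induction {p : n → Prop} (mem : ∀ μ, ∀ x ∈ G.part μ, p x)
    (add : ∀ x y, p x → p y → p (x + y)) (x : n) : p x :=
  iSup_induction G.part (motive := p) (G.iSup_weightPart.symm ▸ mem_top) mem
    (mem 0 0 (zero_mem _)) add

lemma lie_mem_part {μ ν : ι → ℕ} {x y : n} (hx : x ∈ G.part μ) (hy : y ∈ G.part ν) :
    ⁅x, y⁆ ∈ G.part (μ + ν) := by
  rw [mem_part] at *
  intro a
  rw [apply_lie_eq_add, hx, hy, lie_smul, smul_lie, ← add_smul]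
  simp [add_comm]

lemma e_mem (a : ι) : G.e a ∈ G.part (Pi.single a 1) := by
  rw [part, G.weightPart_single]
  exact mem_span_singleton_self _

/-- The sum of the components of height at least `k`. -/
def filt (k : ℕ) : Submodule K n := ⨆ μ : {μ : ι → ℕ // k ≤ ∑ a, μ a}, G.part μ

variable {G}

lemma mem_filt {k : ℕ} {μ : ι → ℕ} {x : n} (hx : x ∈ G.part μ) (hk : k ≤ ∑ a, μ a) :
    x ∈ G.filt k :=
  mem_iSup_of_mem (p := fun μ : {μ : ι → ℕ // k ≤ ∑ a, μ a} ↦ G.part μ) ⟨μ, hk⟩ hx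

lemma filt_le {k : ℕ} {S : Submodule K n} (h : ∀ μ, k ≤ ∑ a, μ a → G.part μ ≤ S) : G.filt k ≤ S :=
  iSup_le fun μ ↦ h μ μ.2

lemma filt_antitone : Antitone G.filt :=
  fun _ _ h ↦ filt_le fun _ hμ _ hx ↦ mem_filt hx (h.trans hμ)

lemma mem_filt_one (x : n) : x ∈ G.filt 1 := by
  induction x using G.induction with
  | mem μ x hx =>
    by_cases h : μ = 0
    · have : x = 0 := by simpa [h, part, G.weightPart_zero] using hx
      simp [this]
    · refine mem_filt hx (Nat.one_le_iff_ne_zero.mpr fun h0 ↦ h ?_)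
      ext a
      simpa using Finset.sum_eq_zero_iff.mp h0 a
  | add x y hx hy => exact add_mem hx hy

lemma lie_mem_filt {k l m : ℕ} {x y : n} (hx : x ∈ G.filt k) (hy : y ∈ G.filt l)
    (hm : m ≤ k + l) : ⁅x, y⁆ ∈ G.filt m := by
  refine filt_antitone hm ?_
  let S : Submodule K n := (G.filt (k + l)).comap (LieModule.toEnd K n n x : n →ₗ[K] n)
  suffices G.filt l ≤ S from this hy
  refine filt_le fun ν hν y hy ↦ ?_
  let S' : Submodule K n := (G.filt (k + l)).comap (LieModule.toEnd K n n y : n →ₗ[K] n)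
  suffices G.filt k ≤ S' by
    change ⁅x, y⁆ ∈ G.filt (k + l)
    rw [← lie_skew]
    exact neg_mem (this hx)
  refine filt_le fun μ hμ x hx ↦ mem_filt (G.lie_mem_part hy hx) ?_
  simp only [Pi.add_apply, Finset.sum_add_distrib]
  lia

lemma filt_two : G.filt 2 = span K {m | ∃ x y : n, ⁅x, y⁆ = m} := by
  apply le_antisymm (filt_le G.weightPart_le)
  rw [span_le]
  rintro _ ⟨x, y, rfl⟩
  exact lie_mem_filt (G := G) (mem_filt_one x) (mem_filt_one y) le_rfl

lemma derivation_mem_filt_two (D : LieDerivation K n n) {x : n} (hx : x ∈ G.filt 2) :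
    D x ∈ G.filt 2 := by
  suffices G.filt 2 ≤ (G.filt 2).comap (D : n →ₗ[K] n) from this hx
  nth_rw 1 [filt_two]
  rw [span_le]
  rintro _ ⟨x, y, rfl⟩
  change D ⁅x, y⁆ ∈ G.filt 2
  rw [apply_lie_eq_add]
  exact add_mem (lie_mem_filt (mem_filt_one _) (mem_filt_one _) le_rfl)
    (lie_mem_filt (mem_filt_one _) (mem_filt_one _) le_rfl)

variable (G)

variable [CharZero K]

lemma iSupIndep_part : iSupIndep G.part := by
  have hcomm (a b : ι) : Commute (G.T a : Module.End K n) (G.T b : Module.End K n) := by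
    refine LinearMap.ext fun x ↦ ?_
    induction x using G.induction with
    | mem μ x hx =>
      rw [mem_part] at hx
      simp [hx, smul_comm (μ a : K)]
    | add x y hx hy => rw [map_add, map_add, hx, hy]
  have h := Module.End.independent_iInf_maxGenEigenspace_of_forall_mapsTo
    (fun a ↦ (G.T a : Module.End K n)) fun a b φ ↦
      Module.End.mapsTo_maxGenEigenspace_of_comm (hcomm b a) φ
  refine (h.comp (f := fun (μ : ι → ℕ) a ↦ (μ a : K)) fun μ ν h ↦ ?_).mono fun μ ↦ ?_
  · ext a
    exact Nat.cast_injective (R := K) (congrFun h a)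
  · refine iInf_mono fun a x hx ↦ ?_
    have h1 : x ∈ Module.End.eigenspace (G.T a : Module.End K n) (μ a) := by
      rw [Module.End.mem_eigenspace_iff]
      simpa [sub_eq_zero] using hx
    exact Module.End.genEigenspace_le_maximal _ _ 1 h1

lemma exists_proj : ∃ p : (ι → ℕ) → n →ₗ[K] n, ∀ μ, (∀ x ∈ G.part μ, p μ x = x) ∧
    (∀ ν ≠ μ, ∀ x ∈ G.part ν, p μ x = 0) ∧ ∀ x, p μ x ∈ G.part μ := by
  have hI := DirectSum.isInternal_submodule_of_iSupIndep_of_iSup_eq_top G.iSupIndep_part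
    G.iSup_weightPart
  let := hI.chooseDecomposition
  refine ⟨fun μ ↦ (G.part μ).subtype ∘ₗ DirectSum.component K _ _ μ ∘ₗ
    (DirectSum.decomposeLinearEquiv G.part).toLinearMap, fun μ ↦ ⟨fun x hx ↦ ?_, fun ν hν x hx ↦ ?_,
      fun x ↦ (DirectSum.decompose G.part x μ).2⟩⟩
  · exact DirectSum.decompose_of_mem_same G.part hx
  · exact DirectSum.decompose_of_mem_ne G.part hx hν

/-- The projection onto the component of multidegree `μ`. -/
noncomputable def proj (μ : ι → ℕ) : n →ₗ[K] n := G.exists_proj.choose μ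

lemma proj_of_mem {μ : ι → ℕ} {x : n} (hx : x ∈ G.part μ) : G.proj μ x = x :=
  (G.exists_proj.choose_spec μ).1 x hx

lemma proj_of_mem_ne {μ ν : ι → ℕ} (h : ν ≠ μ) {x : n} (hx : x ∈ G.part ν) : G.proj μ x = 0 :=
  (G.exists_proj.choose_spec μ).2.1 ν h x hx

lemma proj_mem (μ : ι → ℕ) (x : n) : G.proj μ x ∈ G.part μ :=
  (G.exists_proj.choose_spec μ).2.2 x

lemma exists_coord (a : ι) : ∃ c : n →ₗ[K] K, ∀ x, G.proj (Pi.single a 1) x = c x • G.e a := by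
  obtain ⟨f, hf⟩ := Module.exists_dual_forall_apply_eq_one (K := K) (v := fun _ : Unit ↦ G.e a)
    (s := Set.univ) (by simpa using G.e_ne_zero a)
  refine ⟨f ∘ₗ G.proj (Pi.single a 1), fun x ↦ ?_⟩
  have h := G.proj_mem (Pi.single a 1) x
  rw [part, G.weightPart_single, mem_span_singleton] at h
  obtain ⟨c, hc⟩ := h
  rw [LinearMap.comp_apply, ← hc, map_smul, hf () (Set.mem_univ _), smul_eq_mul, mul_one]

/-- The coefficient of `e a` in the component of height one. -/
noncomputable def coord (a : ι) : n →ₗ[K] K := (G.exists_coord a).choose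

lemma proj_single (a : ι) (x : n) : G.proj (Pi.single a 1) x = G.coord a x • G.e a :=
  (G.exists_coord a).choose_spec x

lemma coord_e (a b : ι) : G.coord a (G.e b) = if a = b then 1 else 0 := by
  apply smul_left_injective K (G.e_ne_zero a)
  change _ • _ = _ • _
  rw [← proj_single]
  split_ifs with h
  · rw [h, G.proj_of_mem (G.e_mem b), one_smul]
  · rw [G.proj_of_mem_ne _ (G.e_mem b), zero_smul]
    intro h'
    have := congrFun h' b
    simp [Ne.symm h] at this

variable {G}

lemma proj_eq_zero_of_mem_filt {k : ℕ} {x : n} (hx : x ∈ G.filt k) {μ : ι → ℕ}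
    (hμ : ∑ a, μ a < k) : G.proj μ x = 0 := by
  suffices G.filt k ≤ LinearMap.ker (G.proj μ) from this hx
  refine filt_le fun ν hν x hx ↦ G.proj_of_mem_ne ?_ hx
  rintro rfl
  lia

lemma coord_eq_zero_of_mem_filt {x : n} (hx : x ∈ G.filt 2) (a : ι) : G.coord a x = 0 := by
  have h := G.proj_single a x
  rw [proj_eq_zero_of_mem_filt hx (by simp)] at h
  exact (smul_eq_zero.mp h.symm).resolve_right (G.e_ne_zero a)

lemma eq_single_of_sum_eq_one {μ : ι → ℕ} (h : ∑ a, μ a = 1) : ∃ a, μ = Pi.single a 1 := by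
  obtain ⟨a, -, ha⟩ := Finset.exists_ne_zero_of_sum_ne_zero (h ▸ one_ne_zero)
  refine ⟨a, ?_⟩
  rw [← Finset.add_sum_erase _ _ (Finset.mem_univ a)] at h
  ext b
  by_cases hb : b = a
  · subst hb
    simp
    lia
  · have h0 : ∑ c ∈ Finset.univ.erase a, μ c = 0 := by lia
    simpa [hb] using Finset.sum_eq_zero_iff.mp h0 b (by simpa using hb)

lemma sub_sum_coord_mem_filt (x : n) : x - ∑ a, G.coord a x • G.e a ∈ G.filt 2 := by
  induction x using G.induction with
  | mem μ x hx =>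
    rcases lt_trichotomy (∑ a, μ a) 1 with h | h | h
    · have hx0 : x = 0 := by
        rw [← G.proj_of_mem hx]
        exact proj_eq_zero_of_mem_filt (mem_filt_one x) h
      simp [hx0]
    · obtain ⟨a, rfl⟩ := eq_single_of_sum_eq_one h
      rw [part, G.weightPart_single, mem_span_singleton] at hx
      obtain ⟨c, rfl⟩ := hx
      simp [coord_e]
    · have h2 : x ∈ G.filt 2 := mem_filt hx h
      simpa [coord_eq_zero_of_mem_filt h2] using h2
  | add x y hx hy =>
    convert! add_mem hx hy using 1
    simp only [map_add, add_smul, Finset.sum_add_distrib]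
    abel

lemma proj_lie_e (ν : ι → ℕ) (a : ι) (z : n) :
    G.proj (ν + Pi.single a 1) ⁅G.e a, z⁆ = ⁅G.e a, G.proj ν z⁆ := by
  induction z using G.induction with
  | mem μ z hz =>
    have hl := G.lie_mem_part (G.e_mem a) hz
    rw [add_comm] at hl
    by_cases h : μ = ν
    · subst h
      rw [G.proj_of_mem hl, G.proj_of_mem hz]
    · rw [G.proj_of_mem_ne (by simpa using h) hl, G.proj_of_mem_ne h hz, lie_zero]
  | add x y hx hy => simp [hx, hy]

lemma proj_lie_e_eq_zero {μ : ι → ℕ} {a : ι} (h : μ a = 0) (z : n) :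
    G.proj μ ⁅G.e a, z⁆ = 0 := by
  induction z using G.induction with
  | mem ν z hz =>
    refine G.proj_of_mem_ne ?_ (G.lie_mem_part (G.e_mem a) hz)
    rintro rfl
    simp at h
  | add x y hx hy => simp [hx, hy]

/-- The leading components of a bracket only depend on the height-one part of `x`. -/
lemma proj_lie {m : ℕ} {z : n} (hz : z ∈ G.filt m) {μ : ι → ℕ} (hμ : ∑ a, μ a = m + 1) (x : n) :
    G.proj μ ⁅x, z⁆ = ∑ a, G.coord a x • G.proj μ ⁅G.e a, z⁆ := by
  have h := proj_eq_zero_of_mem_filt (lie_mem_filt (sub_sum_coord_mem_filt x) hz le_rfl)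
    (μ := μ) (by lia)
  rw [sub_lie, map_sub, sub_eq_zero] at h
  rw [h, sum_lie, map_sum]
  simp

lemma coord_derivation (D : LieDerivation K n n) (c : ι) (x : n) :
    G.coord c (D x) = ∑ k, G.coord k x * G.coord c (D (G.e k)) := by
  have h := coord_eq_zero_of_mem_filt (derivation_mem_filt_two D (G.sub_sum_coord_mem_filt x)) c
  rw [map_sub, map_sub, sub_eq_zero] at h
  rw [h]
  simp

lemma T_e (a b : ι) : G.T a (G.e b) = if a = b then G.e b else 0 := by
  rw [G.mem_part.mp (G.e_mem b) a]
  split_ifs with h <;> simp [h]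

lemma coord_T (a c : ι) (x : n) : G.coord c (G.T a x) = if c = a then G.coord c x else 0 := by
  rw [coord_derivation]
  simp only [T_e, apply_ite (G.coord c), coord_e, map_zero]
  split_ifs with h <;> simp [h]

lemma coord_lie_T (D : LieDerivation K n n) (a c d : ι) : G.coord c (⁅G.T a, D⁆ (G.e d)) =
    ((if c = a then 1 else 0) - (if d = a then 1 else 0)) * G.coord c (D (G.e d)) := by
  rw [commutator_apply, map_sub, coord_T, T_e, sub_mul]
  congr 1
  · simp
  · simp only [apply_ite D, apply_ite (G.coord c), map_zero, eq_comm (a := a)]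
    simp

variable (G) in
/-- `a` dominates `b` if some derivation acts on the abelianization by the matrix unit at
`(a, b)`. -/
def Dominates (a b : ι) : Prop :=
  a = b ∨ ∃ D : LieDerivation K n n,
    ∀ c d, G.coord c (D (G.e d)) = if c = a ∧ d = b then 1 else 0

lemma Dominates.of_ne_zero {a b : ι} {D : LieDerivation K n n} (h : G.coord a (D (G.e b)) ≠ 0) :
    G.Dominates a b := by
  by_cases hab : a = b
  · exact .inl hab
  right
  obtain ⟨D₁, hD₁⟩ : ∃ D₁, D₁ = ⁅G.T b, ⁅G.T a, D⁆⁆ := ⟨_, rfl⟩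
  have h₁ (c d : ι) := hD₁ ▸ G.coord_lie_T ⁅G.T a, D⁆ b c d
  refine ⟨(-2 * G.coord a (D (G.e b)))⁻¹ • (D₁ + ⁅G.T a, D₁⁆), fun c d ↦ ?_⟩
  have : G.coord c ((D₁ + ⁅G.T a, D₁⁆) (G.e d)) =
      if c = a ∧ d = b then -2 * G.coord a (D (G.e b)) else 0 := by
    rw [LieDerivation.add_apply, map_add, coord_lie_T, h₁, coord_lie_T]
    by_cases hca : c = a <;> by_cases hcb : c = b <;> by_cases hda : d = a <;>
      by_cases hdb : d = b <;> simp_all [two_mul]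
  rw [LieDerivation.smul_apply, map_smul, this]
  split_ifs
  · exact inv_mul_cancel₀ (by simpa using h)
  · simp

lemma Dominates.refl (a : ι) : G.Dominates a a := .inl rfl

lemma Dominates.trans {a b c : ι} (hab : G.Dominates a b) (hbc : G.Dominates b c) :
    G.Dominates a c := by
  rcases hab with rfl | ⟨D, hD⟩
  · exact hbc
  rcases hbc with rfl | ⟨D', hD'⟩
  · exact .inr ⟨D, hD⟩
  by_cases hac : a = c
  · exact .inl hac
  by_cases hab : a = b
  · exact .inr ⟨D', hab ▸ hD'⟩
  refine .of_ne_zero (D := ⁅D, D'⁆) ?_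
  rw [commutator_apply, map_sub, coord_derivation, coord_derivation (x := D (G.e c))]
  simp [hD, hD', hab]

lemma eq_zero_of_mem_part_of_mem_filt {μ : ι → ℕ} {k : ℕ} {x : n} (hx : x ∈ G.part μ)
    (hx' : x ∈ G.filt k) (h : ∑ a, μ a < k) : x = 0 := by
  rw [← G.proj_of_mem hx, proj_eq_zero_of_mem_filt hx' h]

lemma mem_filt_two {x : n} (h : ∀ a, G.coord a x = 0) : x ∈ G.filt 2 := by
  simpa [h] using G.sub_sum_coord_mem_filt x

lemma Dominates.lie_eq_zero {a b c : ι} (hab : G.Dominates a b) (hcb : c ≠ b)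
    (h : ⁅G.e b, G.e c⁆ = 0) : ⁅G.e a, G.e c⁆ = 0 := by
  rcases hab with rfl | ⟨D, hD⟩
  · exact h
  have hc : D (G.e c) ∈ G.filt 2 := mem_filt_two fun d ↦ by simp [hD, hcb]
  have hb : D (G.e b) - G.e a ∈ G.filt 2 := mem_filt_two fun d ↦ by simp [hD, coord_e]
  have h0 := congrArg D h
  rw [apply_lie_eq_add, map_zero] at h0
  have h1 : ⁅G.e a, G.e c⁆ = -(⁅G.e b, D (G.e c)⁆ + ⁅D (G.e b) - G.e a, G.e c⁆) := by
    rw [sub_lie, ← add_sub_assoc, h0]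
    simp
  refine eq_zero_of_mem_part_of_mem_filt (k := 3) (G.lie_mem_part (G.e_mem a) (G.e_mem c)) ?_
    (by simp [Finset.sum_add_distrib])
  rw [h1]
  exact neg_mem (add_mem (lie_mem_filt (mem_filt_one _) hc le_rfl)
    (lie_mem_filt hb (mem_filt_one _) le_rfl))

lemma Dominates.lie_lie_eq_zero {a b : ι} (hab : G.Dominates a b) (hne : a ≠ b) :
    ⁅G.e a, ⁅G.e a, G.e b⁆⁆ = 0 := by
  obtain ⟨D, hD⟩ := hab.resolve_left hne
  have hmem (a b : ι) : ⁅G.e a, ⁅G.e a, G.e b⁆⁆ ∈ G.part (2 • Pi.single a 1 + Pi.single b 1) := by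
    rw [two_nsmul, add_assoc]
    exact G.lie_mem_part (G.e_mem a) (G.lie_mem_part (G.e_mem a) (G.e_mem b))
  rcases G.weightPart_eq_bot_or a b hne with h | h
  · exact (mem_bot K).mp (h ▸ hmem a b)
  have hba : ⁅G.e b, ⁅G.e b, G.e a⁆⁆ = 0 := (mem_bot K).mp (h ▸ hmem b a)
  have ha : D (G.e a) ∈ G.filt 2 := mem_filt_two fun d ↦ by simp [hD, hne]
  have hb : D (G.e b) - G.e a ∈ G.filt 2 := mem_filt_two fun d ↦ by simp [hD, coord_e]
  have h0 := congrArg D hba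
  rw [apply_lie_eq_add, apply_lie_eq_add, map_zero] at h0
  have h1 : ⁅G.e a, ⁅G.e a, G.e b⁆⁆ = ⁅D (G.e b) - G.e a, ⁅G.e b, G.e a⁆⁆ +
      ⁅G.e b, ⁅G.e b, D (G.e a)⁆⁆ + ⁅G.e b, ⁅D (G.e b) - G.e a, G.e a⁆⁆ := by
    rw [sub_lie, sub_lie, lie_self, sub_zero, ← lie_skew (G.e a) (G.e b), lie_neg, ← sub_eq_zero]
    rw [lie_add] at h0
    rw [← neg_eq_zero, ← h0]
    abel
  refine eq_zero_of_mem_part_of_mem_filt (k := 4) (hmem a b) ?_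
    (by simp [Finset.sum_add_distrib, ← Finset.mul_sum])
  rw [h1]
  refine add_mem (add_mem ?_ ?_) ?_
  · exact lie_mem_filt hb (lie_mem_filt (mem_filt_one _) (mem_filt_one _) le_rfl) le_rfl
  · exact lie_mem_filt (mem_filt_one _) (lie_mem_filt (mem_filt_one _) ha le_rfl) le_rfl
  · exact lie_mem_filt (mem_filt_one _) (lie_mem_filt hb (mem_filt_one _) le_rfl) le_rfl

omit [CharZero K] in
lemma toEnd_pow_mem_filt (x y : n) (k : ℕ) : (LieModule.toEnd K n n x ^ k) y ∈ G.filt (k + 1) := by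
  induction k with
  | zero => exact mem_filt_one _
  | succ k ih =>
    rw [pow_succ', Module.End.mul_apply, LieModule.toEnd_apply_apply]
    exact lie_mem_filt (mem_filt_one _) ih (by lia)

lemma proj_lie_pair {a b : ι} (hab : a ≠ b) {k : ℕ} {z : n} (hz : z ∈ G.filt (k + 1)) (x : n) :
    G.proj ((k + 1) • Pi.single a 1 + Pi.single b 1) ⁅x, z⁆ =
      G.coord a x • ⁅G.e a, G.proj (k • Pi.single a 1 + Pi.single b 1) z⁆ +
      G.coord b x • ⁅G.e b, G.proj ((k + 1) • Pi.single a 1) z⁆ := by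
  rw [proj_lie hz (by simp [Finset.sum_add_distrib, ← Finset.mul_sum]),
    Fintype.sum_eq_add a b hab, G.proj_lie_e, succ_nsmul, add_right_comm, G.proj_lie_e]
  intro c hc
  rw [G.proj_lie_e_eq_zero (by simp [hc.1, hc.2]), smul_zero]

lemma proj_toEnd_pow {a b : ι} (hab : a ≠ b) (x y : n) (k : ℕ) :
    G.proj ((k + 1) • Pi.single a 1 + Pi.single b 1) ((LieModule.toEnd K n n x ^ (k + 1)) y) =
      (G.coord a x ^ k * (G.coord a x * G.coord b y - G.coord b x * G.coord a y)) •
        (LieModule.toEnd K n n (G.e a) ^ (k + 1)) (G.e b) := by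
  rw [pow_succ', Module.End.mul_apply, LieModule.toEnd_apply_apply,
    proj_lie_pair hab (toEnd_pow_mem_filt x y k)]
  induction k with
  | zero =>
    rw [zero_add, zero_nsmul, zero_add, one_nsmul, pow_zero, Module.End.one_apply, proj_single,
      proj_single, ← lie_skew (G.e b)]
    simp
    module
  | succ k ih =>
    have h0 : G.proj ((k + 1 + 1) • Pi.single a 1) ((LieModule.toEnd K n n x ^ (k + 1)) y) = 0 := by
      have h := G.proj_mem ((k + 1 + 1) • Pi.single a 1) ((LieModule.toEnd K n n x ^ (k + 1)) y)
      rwa [part, G.weightPart_nsmul a _ (by lia), mem_bot] at h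
    rw [h0, lie_zero, smul_zero, add_zero, pow_succ' (LieModule.toEnd K n n x),
      Module.End.mul_apply, LieModule.toEnd_apply_apply,
      proj_lie_pair hab (toEnd_pow_mem_filt x y k), ih, lie_smul, smul_smul, pow_succ' _ (k + 1),
      Module.End.mul_apply, LieModule.toEnd_apply_apply, ← mul_assoc, ← pow_succ']

lemma toEnd_pow_e_eq_zero {a b : ι} (hab : a ≠ b) {x y : n} {k : ℕ}
    (h : (LieModule.toEnd K n n x ^ (k + 1)) y = 0) (hx : k = 0 ∨ G.coord a x ≠ 0)
    (hm : G.coord a x * G.coord b y - G.coord b x * G.coord a y ≠ 0) :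
    (LieModule.toEnd K n n (G.e a) ^ (k + 1)) (G.e b) = 0 := by
  have h' := proj_toEnd_pow hab x y k (G := G)
  rw [h, map_zero, eq_comm, smul_eq_zero] at h'
  refine h'.resolve_left (mul_ne_zero ?_ hm)
  rcases hx with rfl | hx
  · simp
  · exact pow_ne_zero k hx

lemma _root_.Matrix.exists_equiv_forall_apply_ne_zero {m m' R : Type*} [Fintype m] [Fintype m']
    [DecidableEq m] [DecidableEq m'] [Field R] {A : Matrix m m' R} {B : Matrix m' m R}
    (hAB : A * B = 1) (hBA : B * A = 1) : ∃ σ : m' ≃ m, ∀ i, A (σ i) i ≠ 0 := by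
  have hcard : Fintype.card m' = Fintype.card m := by
    have := (LinearEquiv.ofLinearMap A.toLin' B.toLin'
      (by rw [← Matrix.toLin'_mul, hAB, Matrix.toLin'_one])
      (by rw [← Matrix.toLin'_mul, hBA, Matrix.toLin'_one])).finrank_eq
    simpa using this
  let ε := Fintype.equivOfCardEq hcard
  have hdet : (A.submatrix ε id).det ≠ 0 := by
    refine left_ne_zero_of_mul_eq_one (b := (B.submatrix id ε).det) ?_
    rw [← Matrix.det_mul, ← Matrix.submatrix_mul A B ε id ε Function.bijective_id, hAB,
      Matrix.submatrix_one_equiv, Matrix.det_one]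
  rw [Matrix.det_apply] at hdet
  obtain ⟨τ, -, hτ⟩ := Finset.exists_ne_zero_of_sum_ne_zero hdet
  refine ⟨τ.trans ε, fun i h ↦ hτ ?_⟩
  rw [Finset.prod_eq_zero (Finset.mem_univ i) (by simpa using h), smul_zero]

section Comparison

variable {κ : Type*} [Fintype κ] [DecidableEq κ] (G' : NilradicalGrading K n κ)

lemma coord_eq_sum (a : κ) (x : n) :
    G'.coord a x = ∑ i, G.coord i x * G'.coord a (G.e i) := by
  have h := G.sub_sum_coord_mem_filt x
  rw [filt_two, ← G'.filt_two] at h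
  have h' := coord_eq_zero_of_mem_filt h a
  rw [map_sub, sub_eq_zero] at h'
  rw [h']
  simp

variable (G) in
lemma sum_coord_mul_coord (a b : κ) :
    ∑ i, G.coord i (G'.e b) * G'.coord a (G.e i) = if a = b then 1 else 0 := by
  rw [← coord_eq_sum, coord_e]

variable {G'}

lemma Dominates.of_coord_ne_zero {a b : κ} {i : ι} (ha : G'.coord a (G.e i) ≠ 0)
    (hb : G.coord i (G'.e b) ≠ 0) : G'.Dominates a b := by
  refine .of_ne_zero (D := G.T i) ?_
  rw [coord_eq_sum (G := G)]
  simp [coord_T, ha, hb]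

lemma Dominates.symm_of_perm {π : Equiv.Perm ι} (hπ : ∀ a, G.Dominates (π a) a) (a : ι) :
    G.Dominates a (π a) := by
  have h (k : ℕ) (a : ι) : G.Dominates ((π ^ k) a) a := by
    induction k with
    | zero => exact .refl a
    | succ k ih =>
      rw [pow_succ', Equiv.Perm.mul_apply]
      exact (hπ _).trans ih
  have h' := h (orderOf π - 1) (π a)
  rwa [← Equiv.Perm.mul_apply, ← pow_succ, Nat.sub_add_cancel (orderOf_pos π), pow_orderOf_eq_one,
    Equiv.Perm.one_apply] at h'

variable (G G') in
lemma exists_equiv_dominates : ∃ σ : ι ≃ κ, (∀ i, G'.coord (σ i) (G.e i) ≠ 0) ∧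
    ∀ i a, G'.coord a (G.e i) ≠ 0 → G'.Dominates a (σ i) := by
  let A : Matrix κ ι K := .of fun a i ↦ G'.coord a (G.e i)
  let B : Matrix ι κ K := .of fun i a ↦ G.coord i (G'.e a)
  have hAB : A * B = 1 := by
    ext a b
    simp [A, B, Matrix.mul_apply, Matrix.one_apply, ← G.sum_coord_mul_coord G' a b, mul_comm]
  have hBA : B * A = 1 := by
    ext a b
    simp [A, B, Matrix.mul_apply, Matrix.one_apply, ← G'.sum_coord_mul_coord G a b, mul_comm]
  obtain ⟨σ, hσ⟩ := Matrix.exists_equiv_forall_apply_ne_zero hAB hBA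
  obtain ⟨τ, hτ⟩ := Matrix.exists_equiv_forall_apply_ne_zero hBA hAB
  refine ⟨σ, hσ, fun i a ha ↦ ?_⟩
  have h1 : G'.Dominates a (τ.symm i) := .of_coord_ne_zero ha (by simpa [B] using hτ (τ.symm i))
  have h2 := Dominates.symm_of_perm (G := G') (π := τ.trans σ)
    (fun b ↦ .of_coord_ne_zero (hσ (τ b)) (hτ b)) (τ.symm i)
  simpa using h1.trans h2

variable (G G') in
theorem exists_equiv_toEnd_pow_eq_zero : ∃ σ : ι ≃ κ, ∀ i j, i ≠ j → ∀ k : ℕ,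
    (LieModule.toEnd K n n (G.e i) ^ (k + 1)) (G.e j) = 0 →
      (LieModule.toEnd K n n (G'.e (σ i)) ^ (k + 1)) (G'.e (σ j)) = 0 := by
  obtain ⟨σ, hσ, hdom⟩ := exists_equiv_dominates G G'
  refine ⟨σ, fun i j hij k h ↦ ?_⟩
  have hab : σ i ≠ σ j := by simpa using hij
  by_cases hm : G'.coord (σ i) (G.e i) * G'.coord (σ j) (G.e j) -
      G'.coord (σ j) (G.e i) * G'.coord (σ i) (G.e j) ≠ 0
  · exact toEnd_pow_e_eq_zero hab h (.inr (hσ i)) hm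
  rw [not_not, sub_eq_zero] at hm
  have hne := hm ▸ mul_ne_zero (hσ i) (hσ j)
  have hji : G'.Dominates (σ j) (σ i) := hdom i _ (left_ne_zero_of_mul hne)
  have hij' : G'.Dominates (σ i) (σ j) := hdom j _ (right_ne_zero_of_mul hne)
  cases k with
  | succ k =>
    rw [pow_succ, Module.End.mul_apply, LieModule.toEnd_apply_apply, pow_succ, Module.End.mul_apply,
      LieModule.toEnd_apply_apply, hij'.lie_lie_eq_zero hab, map_zero]
  | zero =>
    have hsum : ∑ a, ∑ b, G.coord i (G'.e a) * G.coord j (G'.e b) *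
        (G'.coord a (G.e i) * G'.coord b (G.e j) - G'.coord b (G.e i) * G'.coord a (G.e j)) = 1 := by
      have h1 := congr($(G'.sum_coord_mul_coord G i i) * $(G'.sum_coord_mul_coord G j j) -
        $(G'.sum_coord_mul_coord G i j) * $(G'.sum_coord_mul_coord G j i))
      rw [if_pos rfl, if_pos rfl, if_neg hij, zero_mul, mul_one, sub_zero, Finset.sum_mul_sum,
        Finset.sum_mul_sum, ← Finset.sum_sub_distrib] at h1
      rw [← h1]
      refine Finset.sum_congr rfl fun a _ ↦ ?_
      rw [← Finset.sum_sub_distrib]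
      exact Finset.sum_congr rfl fun b _ ↦ by ring
    obtain ⟨a, -, ha⟩ := Finset.exists_ne_zero_of_sum_ne_zero (hsum ▸ one_ne_zero)
    obtain ⟨b, -, hb⟩ := Finset.exists_ne_zero_of_sum_ne_zero ha
    have hm' := right_ne_zero_of_mul hb
    have hne' : a ≠ b := by
      rintro rfl
      exact hm' (by ring)
    have ha' : G'.Dominates (σ i) a :=
      .of_coord_ne_zero (hσ i) (left_ne_zero_of_mul (left_ne_zero_of_mul hb))
    have hb' : G'.Dominates (σ j) b :=
      .of_coord_ne_zero (hσ j) (right_ne_zero_of_mul (left_ne_zero_of_mul hb))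
    have h0 := toEnd_pow_e_eq_zero hne' h (.inl rfl) hm'
    have hskew {x y : n} (h : ⁅x, y⁆ = 0) : ⁅y, x⁆ = 0 := by rw [← lie_skew, h, neg_zero]
    simp only [zero_add, pow_one, LieModule.toEnd_apply_apply] at h0 ⊢
    by_cases hbi : b = σ i
    · subst hbi
      by_cases haj : a = σ j
      · exact hskew (haj ▸ h0)
      · exact ha'.lie_eq_zero (Ne.symm haj) (hskew (hji.lie_eq_zero hne' (hskew h0)))
    · exact hskew (hb'.lie_eq_zero (Ne.symm hbi) (hskew (ha'.lie_eq_zero hne'.symm h0)))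

end Comparison

end NilradicalGrading

namespace LieAlgebra.IsKilling

open LieModule Module

variable {K L : Type*} [Field K] [CharZero K] [LieRing L] [LieAlgebra K L] [Module.Finite K L]
  [IsKilling K L] {H : LieSubalgebra K L} [H.IsCartanSubalgebra] [LieModule.IsTriangularizable K H L]
  {ι : Type*} [Fintype ι] {b : (rootSystem H).Base} (ε : ι ≃ b.support)

/-- The combination of simple roots with given natural coefficients. -/
noncomputable def combination (μ : ι → ℕ) : Dual K H := ∑ a, μ a • (rootSystem H).root (ε a)

lemma combination_add (μ ν : ι → ℕ) :
    combination ε (μ + ν) = combination ε μ + combination ε ν := by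
  simp [combination, add_smul, Finset.sum_add_distrib]

lemma combination_nsmul (k : ℕ) (μ : ι → ℕ) :
    combination ε (k • μ) = k • combination ε μ := by
  simp [combination, Finset.smul_sum, mul_smul]

lemma combination_single [DecidableEq ι] (a : ι) :
    combination ε (Pi.single a 1) = (rootSystem H).root (ε a) := by
  simp [combination, Pi.single_apply, ite_smul]

lemma exists_dual_basis [DecidableEq ι] :
    ∃ w : Module.Basis ι K H, ∀ μ a, combination ε μ (w a) = μ a := by
  let v := b.toWeightBasis.reindex ε.symm
  refine ⟨v.dualBasis.map (Module.evalEquiv K H).symm, fun μ a ↦ ?_⟩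
  have h (c : ι) : (rootSystem H).root (ε c) (v.dualBasis.map (Module.evalEquiv K H).symm a) =
      if c = a then 1 else 0 := by
    rw [← v.dualBasis_apply_self, Module.Basis.map_apply, Module.apply_evalEquiv_symm_apply]
    simp [v]
  simp only [combination, LinearMap.sum_apply, LinearMap.smul_apply, h]
  simp

lemma combination_injective : Function.Injective (combination (K := K) (H := H) ε) := by
  classical
  obtain ⟨w, hw⟩ := exists_dual_basis ε
  intro μ ν h
  ext a
  have := hw μ a
  rw [h, hw] at this
  exact_mod_cast this.symm

lemma exists_combination_eq_root {j : H.root} (hj : b.IsPos j) :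
    ∃ ν, combination ε ν = (rootSystem H).root j := by
  classical
  refine hj.induction_on_add (p := fun j ↦ ∃ ν, combination ε ν = (rootSystem H).root j)
    (fun i hi ↦ ?_) ?_
  · exact ⟨Pi.single (ε.symm ⟨i, hi⟩) 1, by rw [combination_single, Equiv.apply_symm_apply]⟩
  · rintro i j k hk ⟨ν, hν⟩ hj
    refine ⟨ν + Pi.single (ε.symm ⟨j, hj⟩) 1, ?_⟩
    rw [combination_add, combination_single, hk, hν, Equiv.apply_symm_apply]

/-- A positive root of height at least two is the sum of a positive root and a simple root. -/
lemma exists_root_add_simple_eq {μ : ι → ℕ} (hμ : 2 ≤ ∑ a, μ a) {j : H.root} (hj : b.IsPos j)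
    (h : combination ε μ = (rootSystem H).root j) : ∃ k, b.IsPos k ∧ ∃ a,
      (rootSystem H).root j = (rootSystem H).root (ε a) + (rootSystem H).root k := by
  classical
  obtain ⟨l, hl, hlj⟩ := hj.exists_mem_support_pos_pairingIn
  rw [(rootSystem H).zero_lt_pairingIn_iff'] at hlj
  have hne : j ≠ l := by
    rintro rfl
    have h1 := combination_single ε (ε.symm ⟨j, hl⟩)
    rw [Equiv.apply_symm_apply] at h1
    rw [combination_injective ε (h.trans h1.symm)] at hμ
    simp at hμ
  obtain ⟨k, hk⟩ := (rootSystem H).root_sub_root_mem_of_pairingIn_pos hlj hne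
  refine ⟨k, hj.sub hl hk, ε.symm ⟨l, hl⟩, ?_⟩
  rw [Equiv.apply_symm_apply, hk]
  simp

lemma combination_notMem_or {a c : ι} [DecidableEq ι] (hac : a ≠ c) :
    combination ε (2 • Pi.single a 1 + Pi.single c 1) ∉ Set.range (rootSystem H).root ∨
    combination ε (2 • Pi.single c 1 + Pi.single a 1) ∉ Set.range (rootSystem H).root := by
  by_contra! h
  have hne : ε a ≠ ε c := ε.injective.ne hac
  simp only [combination_add, combination_nsmul, combination_single] at h
  rw [add_comm, RootPairing.root_add_nsmul_mem_range_iff_le_chainTopCoeff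
    (b.linearIndependent_pair_of_ne hne), add_comm,
    RootPairing.root_add_nsmul_mem_range_iff_le_chainTopCoeff
    (b.linearIndependent_pair_of_ne hne.symm)] at h
  have h1 := b.chainTopCoeff_eq_of_ne hne
  have h2 := b.chainTopCoeff_eq_of_ne hne.symm
  have h3 := (rootSystem H).pairingIn_pairingIn_mem_set_of_isCrystal_of_isRed' (ε a) (ε c)
    (fun h ↦ hne (Subtype.ext ((rootSystem H).root.injective h)))
    (b.root_ne_neg_of_ne (ε a).2 (ε c).2 (by simpa [Subtype.ext_iff] using hne))
  simp only [Set.mem_insert_iff, Set.mem_singleton_iff, Prod.mk.injEq] at h3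
  omega

variable {n : Type*} [LieRing n] [LieAlgebra K n] {i : n →ₗ⁅K⁆ L}

omit [CharZero K] [Module.Finite K L] [IsKilling K L] [H.IsCartanSubalgebra]
  [LieModule.IsTriangularizable K H L] in
lemma exists_derivation_restrict (hi : Function.Injective i) (h : H)
    (hr : ∀ x : n, ∃ y : n, i y = ⁅(h : L), i x⁆) :
    ∃ T : LieDerivation K n n, ∀ x, i (T x) = ⁅(h : L), i x⁆ := by
  choose T hT using hr
  refine ⟨⟨⟨⟨T, fun x y ↦ hi ?_⟩, fun c x ↦ hi ?_⟩, fun x y ↦ hi ?_⟩, hT⟩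
  · simp [hT]
  · simp [hT]
  · simp only [LieHom.map_lie, hT, LinearMap.coe_mk, AddHom.coe_mk, map_sub]
    rw [← lie_skew (i y), leibniz_lie]
    abel

omit [Fintype ι] in
lemma exists_isPos_of_mem_rootSpace (hi : Function.Injective i)
    (hr : LinearMap.range (i : n →ₗ[K] L) =
      ⨆ (j) (_ : b.IsPos j), (rootSpace H ((rootSystem H).root j)).toSubmodule)
    {χ : Dual K H} {x : n} (hx : i x ∈ rootSpace H χ) (hx0 : x ≠ 0) :
    ∃ j, b.IsPos j ∧ (rootSystem H).root j = χ := by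
  by_contra! h
  have hind := (LieSubmodule.iSupIndep_toSubmodule.mpr (iSupIndep_genWeightSpace K H L))
  have hd := hind (χ : H → K)
  refine hx0 (hi ?_)
  rw [map_zero]
  refine (Submodule.disjoint_def.mp hd) _ hx ?_
  have h1 : i x ∈ LinearMap.range (i : n →ₗ[K] L) := ⟨x, rfl⟩
  rw [hr] at h1
  refine (iSup₂_le fun j hj ↦ ?_ : _ ≤ (_ : Submodule K L)) h1
  exact le_iSup₂_of_le (f := fun (ψ : H → K) (_ : ψ ≠ χ) ↦ (genWeightSpace L ψ).toSubmodule)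
    ((rootSystem H).root j : H → K) (fun h0 ↦ h j hj (DFunLike.coe_injective h0)) le_rfl

lemma rootSpace_root_ne_bot (j : H.root) : rootSpace H ((rootSystem H).root j) ≠ ⊥ := j.1.2

lemma toEnd_pow_apply_eq_zero_iff {α β : H.root}
    (hli : LinearIndependent K ![(rootSystem H).root α, (rootSystem H).root β]) {e x : L}
    (he : e ∈ rootSpace H ((rootSystem H).root α)) (he0 : e ≠ 0)
    (hx : x ∈ rootSpace H ((rootSystem H).root β)) (hx0 : x ≠ 0) (k : ℕ) :
    (toEnd K L L e ^ k) x = 0 ↔ RootPairing.chainTopCoeff (P := rootSystem H) α β < k := by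
  have hmem (m : ℕ) : (toEnd K L L e ^ m) x ∈
      rootSpace H (((rootSystem H).root β + m • (rootSystem H).root α : Dual K H) : H → K) := by
    have := toEnd_pow_apply_mem he hx m
    rw [add_comm]
    exact this
  rw [← not_iff_not, not_lt]
  constructor
  · intro h
    rw [← RootPairing.root_add_nsmul_mem_range_iff_le_chainTopCoeff hli]
    refine exists_root_eq_of_rootSpace_ne_bot (fun h0 ↦ ?_) fun hb ↦ h ?_
    · have := LinearIndependent.pair_iff.mp hli (k : K) 1 (by
        rw [one_smul, Nat.cast_smul_eq_nsmul, add_comm, h0])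
      exact one_ne_zero this.2
    · have h1 := hmem k
      rw [hb] at h1
      simpa using h1
  · induction k with
    | zero => intro _; simpa using hx0
    | succ k ih =>
      intro hk
      have h1 := ih (by lia)
      obtain ⟨γ, hγ⟩ := (RootPairing.root_add_nsmul_mem_range_iff_le_chainTopCoeff hli).mpr
        (show k ≤ _ by lia)
      obtain ⟨δ, hδ⟩ := (RootPairing.root_add_nsmul_mem_range_iff_le_chainTopCoeff hli).mpr hk
      have h2 := hmem k
      rw [← hγ] at h2
      rw [pow_succ', Module.End.mul_apply, toEnd_apply_apply]
      refine lie_ne_zero_of_mem_rootSpace (H.isNonZero_coe_root α) (H.isNonZero_coe_root γ)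
        ?_ he he0 h2 h1
      have h3 : (rootSystem H).root α + (rootSystem H).root γ = (rootSystem H).root δ := by
        rw [hγ, hδ]; module
      have h4 : (α.1 + γ.1 : H → K) = (rootSystem H).root δ := by
        rw [← h3]; rfl
      rw [h4]
      exact rootSpace_root_ne_bot δ

theorem exists_nilradicalGrading [DecidableEq ι] (hi : Function.Injective i)
    (hr : LinearMap.range (i : n →ₗ[K] L) =
      ⨆ (j) (_ : b.IsPos j), (rootSpace H ((rootSystem H).root j)).toSubmodule) :
    ∃ G : NilradicalGrading K n ι, ∀ a c, a ≠ c → ∀ k : ℕ, (toEnd K n n (G.e a) ^ k) (G.e c) = 0 ↔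
      RootPairing.chainTopCoeff (P := rootSystem H) (ε a) (ε c) < k := by
  obtain ⟨w, hw⟩ := exists_dual_basis ε
  have hstab (a : ι) (x : n) : ∃ y : n, i y = ⁅(w a : L), i x⁆ := by
    have h1 : i x ∈ LinearMap.range (i : n →ₗ[K] L) := ⟨x, rfl⟩
    suffices h2 : ⁅(w a : L), i x⁆ ∈ LinearMap.range (i : n →ₗ[K] L) from h2
    rw [hr] at h1 ⊢
    simp_rw [← LieSubmodule.iSup_toSubmodule] at h1 ⊢
    exact LieSubmodule.lie_mem (x := w a) _ h1
  choose T hT using fun a ↦ exists_derivation_restrict hi (w a) (hstab a)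
  have hpart (μ : ι → ℕ) (x : n) : x ∈ LieDerivation.weightPart T μ ↔
      i x ∈ rootSpace H (combination ε μ) := by
    have h1 : x ∈ LieDerivation.weightPart T μ ↔ ∀ a, T a x = (μ a : K) • x := by
      simp [LieDerivation.weightPart, sub_eq_zero]
    rw [h1]
    refine ⟨fun h ↦ weightSpace_le_genWeightSpace L _ ((mem_weightSpace ..).mpr fun y ↦ ?_),
      fun h a ↦ hi ?_⟩
    · have h2 : (toEnd K H L : H →ₗ[K] Module.End K L).flip (i x) =
          (combination ε μ).smulRight (i x) := w.ext fun a ↦ by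
        have := hT a x
        rw [h, map_smul] at this
        simpa [hw] using this.symm
      exact LinearMap.congr_fun h2 y
    · rw [hT, map_smul, ← hw μ a]
      exact lie_eq_smul_of_mem_rootSpace h (w a)
  have hbot {μ : ι → ℕ} (h : combination ε μ ∉ Set.range (rootSystem H).root) :
      LieDerivation.weightPart T μ = ⊥ := by
    rw [Submodule.eq_bot_iff]
    intro x hx
    by_contra hx0
    obtain ⟨j, -, hj⟩ := exists_isPos_of_mem_rootSpace hi hr ((hpart μ x).mp hx) hx0
    exact h ⟨j, hj⟩
  have hlift {j : H.root} (hj : b.IsPos j) {x : L} (hx : x ∈ rootSpace H ((rootSystem H).root j)) :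
      ∃ y, i y = x := by
    suffices h2 : x ∈ LinearMap.range (i : n →ₗ[K] L) from h2
    rw [hr]
    exact (le_iSup₂_of_le (f := fun j (_ : b.IsPos j) ↦
      (rootSpace H ((rootSystem H).root j)).toSubmodule) j hj le_rfl) hx
  have hlift_ne {j : H.root} (hj : b.IsPos j) :
      ∃ y, y ≠ 0 ∧ i y ∈ rootSpace H ((rootSystem H).root j) := by
    obtain ⟨x, hx, hx0⟩ := j.1.exists_ne_zero
    obtain ⟨y, rfl⟩ := hlift hj hx
    exact ⟨y, by rintro rfl; simp at hx0, hx⟩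
  choose e he0 he using fun a ↦ hlift_ne (b.isPos_of_mem_support (ε a).2)
  refine ⟨⟨e, T, ?_, ?_, ?_, he0, ?_, ?_, ?_⟩, ?_⟩
  · rw [eq_top_iff]
    rintro x -
    have h1 : i x ∈ LinearMap.range (i : n →ₗ[K] L) := ⟨x, rfl⟩
    have h2 : LinearMap.range (i : n →ₗ[K] L) ≤
        (⨆ μ, LieDerivation.weightPart T μ).map (i : n →ₗ[K] L) := by
      rw [hr]
      refine iSup₂_le fun j hj y hy ↦ ?_
      obtain ⟨ν, hν⟩ := exists_combination_eq_root ε hj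
      obtain ⟨z, rfl⟩ := hlift hj hy
      exact ⟨z, Submodule.mem_iSup_of_mem ν ((hpart ν z).mpr (hν ▸ hy)), rfl⟩
    obtain ⟨z, hz, hzx⟩ := h2 h1
    rwa [← hi hzx]
  · refine hbot ?_
    rintro ⟨j, hj⟩
    refine (rootSystem H).ne_zero j ?_
    simp [hj, combination]
  · intro a
    ext x
    rw [hpart, combination_single, Submodule.mem_span_singleton]
    constructor
    · intro hx
      obtain ⟨c, hc⟩ := exists_smul_eq_of_mem_rootSpace (H.isNonZero_coe_root (ε a)) (he a)
        (fun h ↦ he0 a (hi (by rw [h, map_zero]))) hx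
      exact ⟨c, hi (by rw [map_smul, hc])⟩
    · rintro ⟨c, rfl⟩
      rw [map_smul]
      exact Submodule.smul_mem _ c (he a)
  · intro a k hk
    refine hbot ?_
    rw [combination_nsmul, combination_single]
    have : k.AtLeastTwo := ⟨hk⟩
    have : IsAddTorsionFree (Dual K H) := .of_isTorsionFree K _
    exact (rootSystem H).nsmul_notMem_range_root
  · intro μ hμ x hx
    by_cases hx0 : x = 0
    · rw [hx0]
      exact zero_mem _
    rw [hpart] at hx
    obtain ⟨j, hj, hjμ⟩ := exists_isPos_of_mem_rootSpace hi hr hx hx0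
    obtain ⟨k, hk, a, ha⟩ := exists_root_add_simple_eq ε hμ hj hjμ.symm
    obtain ⟨y, hy0, hy⟩ := hlift_ne hk
    have hsum : ((ε a).1.1 + k.1 : H → K) = (rootSystem H).root j := by
      rw [ha]; rfl
    have hne : ⁅i (e a), i y⁆ ≠ 0 := lie_ne_zero_of_mem_rootSpace (H.isNonZero_coe_root (ε a))
      (H.isNonZero_coe_root k) (hsum ▸ rootSpace_root_ne_bot j) (he a)
      (fun h ↦ he0 a (hi (by rw [h, map_zero]))) hy (fun h ↦ hy0 (hi (by rw [h, map_zero])))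
    have hmem : ⁅i (e a), i y⁆ ∈ rootSpace H ((rootSystem H).root j) :=
      hsum ▸ lie_mem_genWeightSpace_of_mem_genWeightSpace (he a) hy
    rw [← hjμ] at hx
    obtain ⟨c, hc⟩ := exists_smul_eq_of_mem_rootSpace (H.isNonZero_coe_root j) hmem hne hx
    have hxc : c • ⁅e a, y⁆ = x := hi (by rw [map_smul, LieHom.map_lie, hc])
    rw [← hxc]
    exact Submodule.smul_mem _ c (Submodule.subset_span ⟨_, _, rfl⟩)
  · intro a c hac
    exact (combination_notMem_or ε hac).imp hbot hbot
  · intro a c hac k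
    have hpow : i ((toEnd K n n (e a) ^ k) (e c)) = (toEnd K L L (i (e a)) ^ k) (i (e c)) := by
      induction k with
      | zero => simp
      | succ k ih =>
        rw [pow_succ', pow_succ', Module.End.mul_apply, Module.End.mul_apply, toEnd_apply_apply,
          toEnd_apply_apply, LieHom.map_lie, ih]
    change (toEnd K n n (e a) ^ k) (e c) = 0 ↔ _
    rw [← toEnd_pow_apply_eq_zero_iff (b.linearIndependent_pair_of_ne (ε.injective.ne hac)) (he a)
      (fun h ↦ he0 a (hi (by rw [h, map_zero]))) (he c)
      (fun h ↦ he0 c (hi (by rw [h, map_zero]))) k, ← hpow]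
    exact ⟨fun h ↦ by rw [h, map_zero], fun h ↦ hi (by rw [h, map_zero])⟩

end LieAlgebra.IsKilling
open LieAlgebra LieAlgebra.IsKilling in
lemma rootSpaceOf_eq_rootSpace [Module.Finite ℂ g] [IsKilling ℂ g] (h : LieSubalgebra ℂ g)
    [h.IsCartanSubalgebra] (α : Module.Dual ℂ h) :
    rootSpaceOf h α = (rootSpace h (α : h → ℂ)).toSubmodule := by
  ext x
  exact ⟨fun hx ↦ LieModule.weightSpace_le_genWeightSpace g _
    ((LieModule.mem_weightSpace ..).mpr hx), fun hx H ↦ lie_eq_smul_of_mem_rootSpace hx H⟩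

open LieAlgebra LieAlgebra.IsKilling in
lemma rootsOf_eq_range_root [Module.Finite ℂ g] [IsKilling ℂ g] (h : LieSubalgebra ℂ g)
    [h.IsCartanSubalgebra] : rootsOf h = Set.range (rootSystem h).root := by
  ext α
  constructor
  · rintro ⟨h0, hα⟩
    rw [rootSpaceOf_eq_rootSpace] at hα
    exact exists_root_eq_of_rootSpace_ne_bot h0 fun hb ↦ hα (by rw [hb]; rfl)
  · rintro ⟨j, rfl⟩
    refine ⟨(rootSystem h).ne_zero j, fun hb ↦ rootSpace_root_ne_bot j ?_⟩
    rw [rootSpaceOf_eq_rootSpace] at hb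
    exact (LieSubmodule.toSubmodule_eq_bot _).mp hb

open LieAlgebra LieAlgebra.IsKilling in
lemma IsPositiveSystem.exists_base [Module.Finite ℂ g] [IsKilling ℂ g] {h : LieSubalgebra ℂ g}
    [h.IsCartanSubalgebra] {P : Set (Module.Dual ℂ h)} (hP : IsPositiveSystem h P) :
    ∃ b : (rootSystem h).Base, ⨆ α ∈ P, rootSpaceOf h α =
      ⨆ (j) (_ : b.IsPos j), (rootSpace h ((rootSystem h).root j)).toSubmodule := by
  obtain ⟨hsub, hneg, hadd⟩ := hP
  rw [rootsOf_eq_range_root] at *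
  obtain ⟨b, hb⟩ := RootPairing.exists_base_isPos_iff (P := rootSystem h)
    (s := {j | (rootSystem h).root j ∈ P}) (fun j ↦ by
      change _ ↔ (rootSystem h).root _ ∉ P
      rw [RootPairing.root_reflectionPerm, RootPairing.reflection_apply_self]
      exact hneg _ ⟨j, rfl⟩)
    fun i hi j hj k hk ↦ by
      have := hadd _ hi _ hj ⟨k, hk⟩
      rwa [← hk] at this
  refine ⟨b, le_antisymm (iSup₂_le fun α hα ↦ ?_) (iSup₂_le fun j hj ↦ ?_)⟩
  · obtain ⟨j, rfl⟩ := hsub hα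
    rw [rootSpaceOf_eq_rootSpace]
    exact le_iSup₂_of_le (f := fun j (_ : b.IsPos j) ↦
      (rootSpace h ((rootSystem h).root j)).toSubmodule) j ((hb j).mpr hα) le_rfl
  · rw [← rootSpaceOf_eq_rootSpace]
    exact le_iSup₂_of_le (f := fun α (_ : α ∈ P) ↦ rootSpaceOf h α) _ ((hb j).mp hj) le_rfl

/-- Two integer-valued functions on pairs of indices which dominate one another after suitable
relabelling agree under the relabelling. -/
lemma eq_comp_of_le_of_le {ι κ : Type*} [Finite ι] [Finite κ] {A : ι → ι → ℕ} {B : κ → κ → ℕ}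
    (σ : ι ≃ κ) (τ : κ ≃ ι) (hσ : ∀ i j, B (σ i) (σ j) ≤ A i j)
    (hτ : ∀ i j, A (τ i) (τ j) ≤ B i j) (i j : ι) : B (σ i) (σ j) = A i j := by
  have := Fintype.ofFinite ι
  have := Fintype.ofFinite κ
  have hB : ∑ p : ι × ι, B (σ p.1) (σ p.2) = ∑ p : κ × κ, B p.1 p.2 :=
    (σ.prodCongr σ).sum_comp fun p ↦ B p.1 p.2
  have hA : ∑ p : κ × κ, A (τ p.1) (τ p.2) = ∑ p : ι × ι, A p.1 p.2 :=
    (τ.prodCongr τ).sum_comp fun p ↦ A p.1 p.2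
  have h1 : ∑ p : ι × ι, B (σ p.1) (σ p.2) = ∑ p : ι × ι, A p.1 p.2 :=
    le_antisymm (Finset.sum_le_sum fun p _ ↦ hσ _ _)
      (by rw [hB, ← hA]; exact Finset.sum_le_sum fun p _ ↦ hτ _ _)
  exact (Finset.sum_eq_sum_iff_of_le fun p _ ↦ hσ p.1 p.2).mp h1 (i, j) (Finset.mem_univ _)

/-- **Complex semisimple Lie algebras are determined by the nilradicals of their Borel
subalgebras.**  If the nilradicals `𝔫ᵢ = ⊕_{α ∈ Δᵢ⁺} (𝔤ᵢ)_α` of Borel subalgebras of two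
finite-dimensional complex semisimple Lie algebras are isomorphic, then so are the
semisimple Lie algebras themselves. -/
theorem nilradical_determines_complex_semisimple
    {g₁ g₂ : Type*} [LieRing g₁] [LieAlgebra ℂ g₁] [LieRing g₂] [LieAlgebra ℂ g₂]
    [Module.Finite ℂ g₁] [Module.Finite ℂ g₂]
    [LieAlgebra.IsKilling ℂ g₁] [LieAlgebra.IsKilling ℂ g₂]
    (h₁ : LieSubalgebra ℂ g₁) (hh₁ : h₁.IsCartanSubalgebra)
    (h₂ : LieSubalgebra ℂ g₂) (hh₂ : h₂.IsCartanSubalgebra)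
    (P₁ : Set (Module.Dual ℂ h₁)) (hP₁ : IsPositiveSystem h₁ P₁)
    (P₂ : Set (Module.Dual ℂ h₂)) (hP₂ : IsPositiveSystem h₂ P₂)
    (n₁ : LieSubalgebra ℂ g₁) (hn₁ : (n₁ : Submodule ℂ g₁) = ⨆ α ∈ P₁, rootSpaceOf h₁ α)
    (n₂ : LieSubalgebra ℂ g₂) (hn₂ : (n₂ : Submodule ℂ g₂) = ⨆ α ∈ P₂, rootSpaceOf h₂ α)
    (h : Nonempty (n₁ ≃ₗ⁅ℂ⁆ n₂)) : Nonempty (g₁ ≃ₗ⁅ℂ⁆ g₂) := by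
  classical
  obtain ⟨φ⟩ := h
  obtain ⟨b₁, hb₁⟩ := hP₁.exists_base
  obtain ⟨b₂, hb₂⟩ := hP₂.exists_base
  have hr₁ : LinearMap.range (n₁.incl : n₁ →ₗ[ℂ] g₁) = (n₁ : Submodule ℂ g₁) :=
    Submodule.range_subtype _
  have hr₂ : LinearMap.range (n₂.incl.comp φ.toLieHom : n₁ →ₗ[ℂ] g₂) = (n₂ : Submodule ℂ g₂) := by
    ext x
    constructor
    · rintro ⟨y, rfl⟩
      exact (φ y).2
    · intro hx
      exact ⟨φ.symm ⟨x, hx⟩, congr_arg Subtype.val (φ.apply_symm_apply ⟨x, hx⟩)⟩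
  obtain ⟨G₁, hG₁⟩ := LieAlgebra.IsKilling.exists_nilradicalGrading (Equiv.refl b₁.support)
    Subtype.val_injective (hr₁.trans (hn₁.trans hb₁))
  obtain ⟨G₂, hG₂⟩ := LieAlgebra.IsKilling.exists_nilradicalGrading (Equiv.refl b₂.support)
    (Subtype.val_injective.comp φ.injective) (hr₂.trans (hn₂.trans hb₂))
  let A (i j : b₁.support) : ℕ :=
    if i = j then 0 else RootPairing.chainTopCoeff (P := LieAlgebra.IsKilling.rootSystem h₁) i j
  let B (i j : b₂.support) : ℕ :=
    if i = j then 0 else RootPairing.chainTopCoeff (P := LieAlgebra.IsKilling.rootSystem h₂) i j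
  obtain ⟨σ, hσ⟩ := G₁.exists_equiv_toEnd_pow_eq_zero G₂
  obtain ⟨τ, hτ⟩ := G₂.exists_equiv_toEnd_pow_eq_zero G₁
  have hBA (i j : b₁.support) : B (σ i) (σ j) = A i j := by
    refine eq_comp_of_le_of_le σ τ (fun i j ↦ ?_) (fun i j ↦ ?_) i j
    · rcases eq_or_ne i j with rfl | hij
      · simp [A, B]
      · simp only [A, B, if_neg hij, if_neg (σ.injective.ne hij)]
        exact Nat.lt_succ_iff.mp ((hG₂ _ _ (σ.injective.ne hij) _).mp
          (hσ i j hij _ ((hG₁ _ _ hij _).mpr (Nat.lt_succ_self _))))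
    · rcases eq_or_ne i j with rfl | hij
      · simp [A, B]
      · simp only [A, B, if_neg hij, if_neg (τ.injective.ne hij)]
        exact Nat.lt_succ_iff.mp ((hG₁ _ _ (τ.injective.ne hij) _).mp
          (hτ i j hij _ ((hG₂ _ _ hij _).mpr (Nat.lt_succ_self _))))
  obtain ⟨B₁, hB₁⟩ := LieAlgebra.IsKilling.exists_basis_of_base b₁ (Equiv.refl b₁.support)
  obtain ⟨B₂, hB₂⟩ := LieAlgebra.IsKilling.exists_basis_of_base b₂ σ
  refine LieAlgebra.Basis.nonempty_equiv_of_A_eq B₁ B₂ ?_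
  ext i j
  rw [hB₁, hB₂]
  rcases eq_or_ne i j with rfl | hij
  · simp
  · have hji := hBA j i
    simp only [A, B, if_neg hij.symm, if_neg (σ.injective.ne hij.symm)] at hji
    rw [b₂.cartanMatrix_eq_neg_chainTopCoeff (σ.injective.ne hij), hji]
    exact b₁.cartanMatrix_eq_neg_chainTopCoeff hij
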